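/- arXiv:1808.01914 — 6 statements merged into one kernel-verified Lean document; each statement's English description precedes it below -/
import Mathlib

section
/- If the abstract Cauchy problem u'(t) = A u(t), u(0) = x has a unique mild solution on [0, τ) for every x ∈ D(A^n), then A is stationary dense with n(A) ≤ n. -/
open Set MeasureTheory Filter

/-- Iterated domain `D(A^k)` of a (possibly unbounded) linear operator, represented as a
total linear map `f` together with its domain submodule `D` (the operator `A` is `f`
restricted to `D`). -/
def dompowS {E : Type*} [AddCommGroup E] [Module ℂ E]
    (f : E →ₗ[ℂ] E) (D : Submodule ℂ E) : ℕ → Submodule ℂ E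
  | 0 => ⊤
  | k + 1 => D ⊓ (dompowS f D k).comap f

/-- The set of `k` such that `D(A^m) ⊆ closure (D(A^{m+1}))` for all `m ≥ k`.
`A` is stationary dense iff this set is nonempty, and `n(A)` is its infimum. -/
def statSet {E : Type*} [NormedAddCommGroup E] [Module ℂ E]
    (f : E →ₗ[ℂ] E) (D : Submodule ℂ E) : Set ℕ :=
  {k | ∀ m, k ≤ m → (dompowS f D m : Set E) ⊆ closure (dompowS f D (m + 1) : Set E)}

/-- `A` (i.e. `f` restricted to `D`) is a closed operator: its graph is closed. -/
def IsClosedOp {E : Type*} [NormedAddCommGroup E] [Module ℂ E]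
    (f : E →ₗ[ℂ] E) (D : Submodule ℂ E) : Prop :=
  IsClosed {p : E × E | p.1 ∈ D ∧ f p.1 = p.2}

/-- The time interval `[0, τ)` (all of `[0,∞)` if `τ = ∞`). -/
def timeSet (τ : ENNReal) : Set ℝ := {t : ℝ | 0 ≤ t ∧ ENNReal.ofReal t < τ}

/-- A mild solution of `u' = Au`, `u(0) = x` on `[0, τ)`:
`u` is continuous and `A ∫₀ᵗ u(s) ds = u(t) - x` for all `t ∈ [0, τ)`. -/
def IsMildSolution {E : Type*} [NormedAddCommGroup E] [NormedSpace ℂ E]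
    (f : E →ₗ[ℂ] E) (D : Submodule ℂ E) (τ : ENNReal) (x : E) (u : ℝ → E) : Prop :=
  ContinuousOn u (timeSet τ) ∧
    ∀ t ∈ timeSet τ, (∫ s in (0:ℝ)..t, u s) ∈ D ∧ f (∫ s in (0:ℝ)..t, u s) = u t - x

/-- The graph of `f` restricted to `D`, as a submodule of `E × E`. -/
def opGraph {E : Type*} [AddCommGroup E] [Module ℂ E]
    (f : E →ₗ[ℂ] E) (D : Submodule ℂ E) : Submodule ℂ (E × E) where
  carrier := {p | p.1 ∈ D ∧ f p.1 = p.2}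
  add_mem' := by
    rintro a b ⟨ha, ha'⟩ ⟨hb, hb'⟩
    exact ⟨D.add_mem ha hb, by simp [ha', hb']⟩
  zero_mem' := ⟨D.zero_mem, by simp⟩
  smul_mem' := by
    rintro c a ⟨ha, ha'⟩
    exact ⟨D.smul_mem c ha, by simp [ha']⟩

/-- The `k`-fold iterated primitive of `u`, based at `0`. -/
noncomputable def iterPrimitive {E : Type*} [NormedAddCommGroup E] [NormedSpace ℝ E]
    (u : ℝ → E) : ℕ → ℝ → E
  | 0 => u
  | k + 1 => fun t => ∫ s in (0:ℝ)..t, iterPrimitive u k s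

theorem dompowS_antitone {E : Type*} [AddCommGroup E] [Module ℂ E]
    (f : E →ₗ[ℂ] E) (D : Submodule ℂ E) : Antitone (dompowS f D) := by
  refine antitone_nat_of_succ_le fun k => ?_
  induction k with
  | zero => exact le_top
  | succ k ih => exact inf_le_inf le_rfl (Submodule.comap_mono ih)

theorem intervalIntegral_mem_of_isClosed {F : Type*} [NormedAddCommGroup F] [NormedSpace ℂ F]
    [CompleteSpace F] {p : Submodule ℂ F} (hp : IsClosed (p : Set F)) {g : ℝ → F} {t : ℝ}
    (ht : 0 ≤ t) (hg : ContinuousOn g (Icc 0 t)) (hmem : ∀ s ∈ Icc 0 t, g s ∈ p) :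
    (∫ s in (0:ℝ)..t, g s) ∈ p := by
  have hint : IntervalIntegrable g volume 0 t :=
    ContinuousOn.intervalIntegrable_of_Icc ht hg
  rw [← Submodule.Quotient.mk_eq_zero]
  have key := p.mkQL.intervalIntegral_comp_comm hint
  have hzero : (∫ s in (0:ℝ)..t, p.mkQL (g s)) = 0 := by
    refine (intervalIntegral.integral_congr (g := fun _ => 0) fun s hs => ?_).trans (by simp)
    rw [uIcc_of_le ht] at hs
    exact (Submodule.Quotient.mk_eq_zero p).2 (hmem s hs)
  exact key.symm.trans hzero

/-- A closed operator commutes with the integral of continuous functions. -/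
theorem IsClosedOp.intervalIntegral {E : Type*} [NormedAddCommGroup E] [NormedSpace ℂ E]
    [CompleteSpace E] {f : E →ₗ[ℂ] E} {D : Submodule ℂ E} (hA : IsClosedOp f D)
    {g h : ℝ → E} {t : ℝ} (ht : 0 ≤ t) (hg : ContinuousOn g (Icc 0 t))
    (hh : ContinuousOn h (Icc 0 t)) (hgh : ∀ s ∈ Icc 0 t, g s ∈ D ∧ f (g s) = h s) :
    (∫ s in (0:ℝ)..t, g s) ∈ D ∧ f (∫ s in (0:ℝ)..t, g s) = ∫ s in (0:ℝ)..t, h s := by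
  have hgraph : (∫ s in (0:ℝ)..t, (g s, h s)) ∈ opGraph f D :=
    intervalIntegral_mem_of_isClosed (p := opGraph f D) hA ht (hg.prodMk hh) hgh
  have hint : IntervalIntegrable (fun s => (g s, h s)) volume 0 t :=
    ContinuousOn.intervalIntegrable_of_Icc ht (hg.prodMk hh)
  have h1 := (ContinuousLinearMap.fst ℝ E E).intervalIntegral_comp_comm hint
  have h2 := (ContinuousLinearMap.snd ℝ E E).intervalIntegral_comp_comm hint
  simp only [ContinuousLinearMap.coe_fst', ContinuousLinearMap.coe_snd'] at h1 h2
  rw [h1, h2]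
  exact hgraph

theorem continuousOn_iterPrimitive {E : Type*} [NormedAddCommGroup E] [NormedSpace ℝ E]
    {u : ℝ → E} {T : ℝ} (hT : 0 ≤ T) (hu : ContinuousOn u (Icc 0 T)) (k : ℕ) :
    ContinuousOn (iterPrimitive u k) (Icc 0 T) := by
  induction k with
  | zero => exact hu
  | succ k ih =>
    have := intervalIntegral.continuousOn_primitive_interval (μ := volume) (a := 0) (b := T)
      (f := iterPrimitive u k) (by
        rw [uIcc_of_le hT]
        exact ih.integrableOn_Icc)
    rwa [uIcc_of_le hT] at this

theorem integral_pow_div_factorial (k : ℕ) (t : ℝ) :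
    (∫ s in (0:ℝ)..t, s ^ k / (k.factorial : ℝ)) = t ^ (k + 1) / ((k + 1).factorial : ℝ) := by
  have : (k.factorial : ℝ) ≠ 0 := by positivity
  rw [intervalIntegral.integral_div, integral_pow, Nat.factorial_succ]
  push_cast
  field_simp
  simp

theorem integral_pow_div_factorial_smul {E : Type*} [NormedAddCommGroup E] [NormedSpace ℝ E]
    [CompleteSpace E] (k : ℕ) (t : ℝ) (x : E) :
    (∫ s in (0:ℝ)..t, (s ^ k / (k.factorial : ℝ)) • x) =
      (t ^ (k + 1) / ((k + 1).factorial : ℝ)) • x := by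
  rw [intervalIntegral.integral_smul_const, integral_pow_div_factorial]

/-- `A J^(k+1) u = J^k u - t^k / k! • x` for a mild solution `u`, where `J` is integration. -/
theorem IsClosedOp.iterPrimitive_succ {E : Type*} [NormedAddCommGroup E] [NormedSpace ℂ E]
    [CompleteSpace E] {f : E →ₗ[ℂ] E} {D : Submodule ℂ E} (hA : IsClosedOp f D)
    {u : ℝ → E} {x : E} {T : ℝ} (hu : ContinuousOn u (Icc 0 T))
    (hsol : ∀ t ∈ Icc 0 T,
      (∫ s in (0:ℝ)..t, u s) ∈ D ∧ f (∫ s in (0:ℝ)..t, u s) = u t - x)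
    (k : ℕ) : ∀ t ∈ Icc 0 T, iterPrimitive u (k + 1) t ∈ D ∧
      f (iterPrimitive u (k + 1) t) =
        iterPrimitive u k t - (t ^ k / (k.factorial : ℝ)) • x := by
  induction k with
  | zero => simpa [iterPrimitive] using hsol
  | succ k ih =>
    intro t ht
    have hsub : Icc 0 t ⊆ Icc 0 T := Icc_subset_Icc_right ht.2
    have hcont (j : ℕ) : ContinuousOn (iterPrimitive u j) (Icc 0 t) :=
      continuousOn_iterPrimitive ht.1 (hu.mono hsub) j
    have hpow : Continuous fun s : ℝ => (s ^ k / (k.factorial : ℝ)) • x := by fun_prop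
    obtain ⟨hmem, heq⟩ := hA.intervalIntegral
      (h := fun s => iterPrimitive u k s - (s ^ k / (k.factorial : ℝ)) • x) ht.1 (hcont (k + 1))
      ((hcont k).sub hpow.continuousOn) fun s hs => ih s (hsub hs)
    refine ⟨hmem, heq.trans ?_⟩
    rw [intervalIntegral.integral_sub (ContinuousOn.intervalIntegrable_of_Icc ht.1 (hcont k))
      (hpow.intervalIntegrable _ _), integral_pow_div_factorial_smul]
    rfl

theorem IsClosedOp.iterPrimitive_mem_dompowS {E : Type*} [NormedAddCommGroup E]
    [NormedSpace ℂ E] [CompleteSpace E] {f : E →ₗ[ℂ] E} {D : Submodule ℂ E}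
    (hA : IsClosedOp f D) {u : ℝ → E} {x : E} {T : ℝ} (hu : ContinuousOn u (Icc 0 T))
    (hsol : ∀ t ∈ Icc 0 T,
      (∫ s in (0:ℝ)..t, u s) ∈ D ∧ f (∫ s in (0:ℝ)..t, u s) = u t - x)
    {m : ℕ} (hx : x ∈ dompowS f D m) {k : ℕ} (hk : k ≤ m + 1) :
    ∀ t ∈ Icc 0 T, iterPrimitive u k t ∈ dompowS f D k := by
  induction k with
  | zero => exact fun _ _ => Submodule.mem_top
  | succ k ih =>
    intro t ht
    obtain ⟨hmem, heq⟩ := hA.iterPrimitive_succ hu hsol k t ht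
    refine ⟨hmem, ?_⟩
    change f _ ∈ dompowS f D k
    rw [heq]
    exact Submodule.sub_mem _ (ih (by omega) t ht)
      (Submodule.smul_of_tower_mem _ _ (dompowS_antitone f D (by omega) hx))

theorem norm_iterPrimitive_sub_le {E : Type*} [NormedAddCommGroup E] [NormedSpace ℝ E]
    [CompleteSpace E] {u : ℝ → E} {x : E} {T ε : ℝ} (hu : ContinuousOn u (Icc 0 T))
    (hε : ∀ t ∈ Icc 0 T, ‖u t - x‖ ≤ ε) (k : ℕ) :
    ∀ t ∈ Icc 0 T, ‖iterPrimitive u k t - (t ^ k / (k.factorial : ℝ)) • x‖ ≤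
      t ^ k / (k.factorial : ℝ) * ε := by
  induction k with
  | zero => simpa [iterPrimitive] using hε
  | succ k ih =>
    intro t ht
    have hsub : Icc 0 t ⊆ Icc 0 T := Icc_subset_Icc_right ht.2
    have hpow : Continuous fun s : ℝ => (s ^ k / (k.factorial : ℝ)) • x := by fun_prop
    have hpow' : Continuous fun s : ℝ => s ^ k / (k.factorial : ℝ) * ε := by fun_prop
    rw [← integral_pow_div_factorial_smul, ← integral_pow_div_factorial,
      ← intervalIntegral.integral_mul_const]
    change ‖(∫ s in (0:ℝ)..t, iterPrimitive u k s) - _‖ ≤ _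
    rw [← intervalIntegral.integral_sub (ContinuousOn.intervalIntegrable_of_Icc ht.1
      (continuousOn_iterPrimitive ht.1 (hu.mono hsub) k)) (hpow.intervalIntegrable _ _)]
    exact intervalIntegral.norm_integral_le_of_norm_le ht.1
      (ae_of_all _ fun s hs => ih s (hsub (Ioc_subset_Icc_self hs)))
      (hpow'.intervalIntegrable _ _)

theorem IsClosedOp.mem_closure_dompowS_succ {E : Type*} [NormedAddCommGroup E]
    [NormedSpace ℂ E] [CompleteSpace E] {f : E →ₗ[ℂ] E} {D : Submodule ℂ E}
    (hA : IsClosedOp f D) {u : ℝ → E} {x : E} {T : ℝ} (hT : 0 < T)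
    (hu : ContinuousOn u (Icc 0 T))
    (hsol : ∀ t ∈ Icc 0 T,
      (∫ s in (0:ℝ)..t, u s) ∈ D ∧ f (∫ s in (0:ℝ)..t, u s) = u t - x)
    {m : ℕ} (hx : x ∈ dompowS f D m) : x ∈ closure (dompowS f D (m + 1) : Set E) := by
  have hu0 : u 0 = x := by
    have := (hsol 0 ⟨le_rfl, hT.le⟩).2
    rw [intervalIntegral.integral_same, map_zero] at this
    exact sub_eq_zero.1 this.symm
  rw [Metric.mem_closure_iff]
  intro ε hε
  obtain ⟨δ, hδ, hball⟩ := Metric.continuousOn_iff.1 hu 0 ⟨le_rfl, hT.le⟩ (ε / 2) (half_pos hε)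
  obtain ⟨t, ht0, htlt⟩ := exists_between (lt_min hδ hT)
  have htδ : t < δ := htlt.trans_le (min_le_left _ _)
  have htT : t ≤ T := (htlt.trans_le (min_le_right _ _)).le
  have hsub : Icc 0 t ⊆ Icc 0 T := Icc_subset_Icc_right htT
  have hclose : ∀ s ∈ Icc 0 t, ‖u s - x‖ ≤ ε / 2 := by
    intro s hs
    have := hball s (hsub hs) (by
      rw [Real.dist_eq, sub_zero, abs_of_nonneg hs.1]
      exact hs.2.trans_lt htδ)
    rw [hu0, dist_eq_norm] at this
    exact this.le
  have hest := norm_iterPrimitive_sub_le (hu.mono hsub) hclose (m + 1) t ⟨ht0.le, le_rfl⟩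
  have hmem := hA.iterPrimitive_mem_dompowS hu hsol hx le_rfl t ⟨ht0.le, htT⟩
  set c : ℝ := t ^ (m + 1) / ((m + 1).factorial : ℝ)
  have hc : 0 < c := by positivity
  refine ⟨c⁻¹ • iterPrimitive u (m + 1) t, Submodule.smul_of_tower_mem _ _ hmem, ?_⟩
  have hdiff : c⁻¹ • iterPrimitive u (m + 1) t - x =
      c⁻¹ • (iterPrimitive u (m + 1) t - c • x) := by
    rw [smul_sub, inv_smul_smul₀ hc.ne']
  rw [dist_comm, dist_eq_norm, hdiff, norm_smul, Real.norm_of_nonneg (inv_nonneg.2 hc.le)]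
  calc c⁻¹ * ‖iterPrimitive u (m + 1) t - c • x‖ ≤ c⁻¹ * (c * (ε / 2)) := by gcongr
    _ = ε / 2 := inv_mul_cancel_left₀ hc.ne' _
    _ < ε := half_lt_self hε

/-- If the abstract Cauchy problem `u' = Au`, `u(0) = x` has a unique mild solution on `[0, τ)`
for every `x ∈ D(A^n)`, then `A` is stationary dense with `n(A) ≤ n`. -/
theorem stmt0 {E : Type*} [NormedAddCommGroup E] [NormedSpace ℂ E] [CompleteSpace E]
    (f : E →ₗ[ℂ] E) (D : Submodule ℂ E) (hA : IsClosedOp f D)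
    (τ : ENNReal) (hτ : 0 < τ) (n : ℕ)
    (h : ∀ x ∈ dompowS f D n, ∃ u, IsMildSolution f D τ x u ∧
      ∀ v, IsMildSolution f D τ x v → EqOn u v (timeSet τ)) :
    (statSet f D).Nonempty ∧ sInf (statSet f D) ≤ n := by
  suffices hmem : n ∈ statSet f D from ⟨⟨n, hmem⟩, Nat.sInf_le hmem⟩
  intro m hm x hx
  obtain ⟨u, ⟨hu, hsol⟩, -⟩ := h x (dompowS_antitone f D hm hx)
  obtain ⟨T, -, hT0, hTτ⟩ := ENNReal.lt_iff_exists_real_btwn.1 hτ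
  have hsub : Icc 0 T ⊆ timeSet τ := fun t ht =>
    ⟨ht.1, (ENNReal.ofReal_le_ofReal ht.2).trans_lt hTτ⟩
  exact hA.mem_closure_dompowS_succ (ENNReal.ofReal_pos.1 hT0) (hu.mono hsub)
    (fun t ht => hsol t (hsub ht)) hx
end

section
/- Let A be a closed operator on a Banach space E and (λ_n) ⊂ ρ(A) a sequence with |λ_n| → ∞ such that there exist C > 0 and k ≥ −1 with ‖R(λ_n : A)‖ ≤ C |λ_n|^k for all n. Then A is stationary dense with n(A) ≤ k + 2. -/
open Set Filter

/-- `R` is the resolvent `R(lam : A)` of the operator `A` (= `f` restricted to `D`). -/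
def IsResolvent {E : Type*} [NormedAddCommGroup E] [NormedSpace ℂ E]
    (f : E →ₗ[ℂ] E) (D : Submodule ℂ E) (lam : ℂ) (R : E →L[ℂ] E) : Prop :=
  (∀ x : E, R x ∈ D ∧ lam • R x - f (R x) = x) ∧
  ∀ x ∈ D, R (lam • x - f x) = x

theorem dompowS_succ_le {E : Type*} [AddCommGroup E] [Module ℂ E]
    (f : E →ₗ[ℂ] E) (D : Submodule ℂ E) (j : ℕ) : dompowS f D (j + 1) ≤ dompowS f D j := by
  induction j with
  | zero => exact le_top
  | succ j ih => exact inf_le_inf_left D (Submodule.comap_mono ih)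

namespace IsResolvent

variable {E : Type*} [NormedAddCommGroup E] [NormedSpace ℂ E]
  {f : E →ₗ[ℂ] E} {D : Submodule ℂ E}

theorem apply_mem_dompowS {l : ℂ} {R : E →L[ℂ] E} (h : IsResolvent f D l R) {j : ℕ} {y : E}
    (hy : y ∈ dompowS f D j) : R y ∈ dompowS f D (j + 1) := by
  induction j with
  | zero => exact ⟨(h.1 y).1, Submodule.mem_top⟩
  | succ j ih =>
    refine ⟨(h.1 y).1, ?_⟩
    have hf : f (R y) = l • R y - y := by
      rw [eq_sub_iff_add_eq, eq_comm, ← sub_eq_iff_eq_add', (h.1 y).2]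
    change f (R y) ∈ dompowS f D (j + 1)
    rw [hf]
    exact Submodule.sub_mem _ (Submodule.smul_mem _ _ (ih (dompowS_succ_le f D j hy))) hy

theorem smul_apply {l : ℂ} {R : E →L[ℂ] E} (h : IsResolvent f D l R) {y : E} (hy : y ∈ D) :
    l • R y = y + R (f y) := by
  have := h.2 y hy
  rw [map_sub, map_smul] at this
  exact sub_eq_iff_eq_add.mp this

/-- If `‖R(λ_n : A)‖ = O(|λ_n|^k)`, then `λ_n^e R(λ_n : A) y → 0` for `y ∈ D(A^j)`, provided
`e ≤ 0` and `e + k < j`. -/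
theorem tendsto_zpow_smul_apply {lam : ℕ → ℂ} {R : ℕ → E →L[ℂ] E}
    (hres : ∀ n, IsResolvent f D (lam n) (R n))
    (hlim : Tendsto (fun n => ‖lam n‖) atTop atTop)
    {C : ℝ} {k : ℤ} (hbound : ∀ n, ‖R n‖ ≤ C * ‖lam n‖ ^ k)
    {j : ℕ} {e : ℤ} (he : e ≤ 0) (hek : e + k < j) {y : E} (hy : y ∈ dompowS f D j) :
    Tendsto (fun n => lam n ^ e • R n y) atTop (nhds 0) := by
  have hne : ∀ᶠ n in atTop, lam n ≠ 0 := by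
    filter_upwards [hlim.eventually_gt_atTop 0] with n hn using norm_pos_iff.mp hn
  have hzpow : ∀ i : ℤ, i < 0 → Tendsto (fun n => ‖lam n‖ ^ i) atTop (nhds 0) := fun i hi =>
    (tendsto_zpow_atTop_zero hi).comp hlim
  induction j generalizing e y with
  | zero =>
    have h0 : Tendsto (fun n => C * ‖lam n‖ ^ (e + k) * ‖y‖) atTop (nhds 0) := by
      simpa using ((hzpow (e + k) (by simpa using hek)).const_mul C).mul_const ‖y‖
    refine squeeze_zero_norm' ?_ h0
    filter_upwards [hne] with n hn
    rw [norm_smul, norm_zpow, zpow_add₀ (norm_ne_zero_iff.mpr hn)]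
    calc ‖lam n‖ ^ e * ‖R n y‖ ≤ ‖lam n‖ ^ e * (C * ‖lam n‖ ^ k * ‖y‖) := by
          gcongr
          exact (R n).le_of_opNorm_le (hbound n) y
      _ = C * (‖lam n‖ ^ e * ‖lam n‖ ^ k) * ‖y‖ := by ring
  | succ j ih =>
    have h1 : Tendsto (fun n => lam n ^ (e - 1) • y) atTop (nhds 0) := by
      rw [tendsto_zero_iff_norm_tendsto_zero]
      simpa [norm_smul, norm_zpow] using (hzpow (e - 1) (by lia)).mul_const ‖y‖
    have h2 := ih (e := e - 1) (by lia) (by push_cast at hek; lia) hy.2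
    have h3 := h1.add h2
    rw [add_zero] at h3
    refine h3.congr' ?_
    filter_upwards [hne] with n hn
    rw [← smul_add, ← (hres n).smul_apply hy.1, smul_smul, zpow_sub_one₀ hn, mul_assoc,
      inv_mul_cancel₀ hn, mul_one]

end IsResolvent

/-- If `(λ_n) ⊆ ρ(A)` with `|λ_n| → ∞` and `‖R(λ_n : A)‖ ≤ C |λ_n|^k` for some `C > 0`,
`k ≥ -1`, then `A` is stationary dense with `n(A) ≤ k + 2`. -/
theorem stmt2 {E : Type*} [NormedAddCommGroup E] [NormedSpace ℂ E] [CompleteSpace E]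
    (f : E →ₗ[ℂ] E) (D : Submodule ℂ E) (hA : IsClosedOp f D)
    (lam : ℕ → ℂ) (R : ℕ → E →L[ℂ] E)
    (hres : ∀ n, IsResolvent f D (lam n) (R n))
    (hlim : Tendsto (fun n => ‖lam n‖) atTop atTop)
    (C : ℝ) (hC : 0 < C) (k : ℤ) (hk : -1 ≤ k)
    (hbound : ∀ n, ‖R n‖ ≤ C * ‖lam n‖ ^ k) :
    (statSet f D).Nonempty ∧ sInf (statSet f D) ≤ (k + 2).toNat := by
  have hmem : (k + 2).toNat ∈ statSet f D := by
    intro m hm x hx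
    obtain ⟨j, rfl⟩ : ∃ j, m = j + 1 := ⟨m - 1, by lia⟩
    have h := IsResolvent.tendsto_zpow_smul_apply hres hlim hbound (e := 0) le_rfl
      (by lia) hx.2
    have h' : Tendsto (fun n => lam n • R n x) atTop (nhds x) := by
      have h3 := h.const_add x
      rw [add_zero] at h3
      refine h3.congr fun n => ?_
      rw [zpow_zero, one_smul, (hres n).smul_apply hx.1]
    exact mem_closure_of_tendsto h' (Eventually.of_forall fun n =>
      Submodule.smul_mem _ _ ((hres n).apply_mem_dompowS hx))
  exact ⟨⟨_, hmem⟩, Nat.sInf_le hmem⟩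
end

section
/- For a closed stationary dense operator A on a Banach space E, n(A) = inf{ k ∈ ℕ₀ : closure(D(A^k)) ⊆ ... } satisfies: D(A^k) ⊆ closure(D(A^m)) for all m ≥ k whenever k ≥ n(A); equivalently, for k ≥ n(A), D(A^k) is contained in the closure of D(A^m) for every m. -/
open Set

/-- Iterated density: for a closed stationary dense operator `A` and `k ≥ n(A)`,
`D(A^k) ⊆ closure(D(A^m))` for every `m ≥ k`. -/
theorem stmt9 {E : Type*} [NormedAddCommGroup E] [NormedSpace ℂ E] [CompleteSpace E]
    (f : E →ₗ[ℂ] E) (D : Submodule ℂ E) (hA : IsClosedOp f D)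
    (hstat : (statSet f D).Nonempty)
    (k : ℕ) (hk : sInf (statSet f D) ≤ k) :
    ∀ m, k ≤ m → (dompowS f D k : Set E) ⊆ closure (dompowS f D m : Set E) := by
  intro m hm
  induction m, hm using Nat.le_induction with
  | base => exact subset_closure
  | succ m hm ih =>
    exact ih.trans (closure_minimal (Nat.sInf_mem hstat m (hk.trans hm)) isClosed_closure)
end

section
/- Let A be a stationary dense closed operator on a Banach space E with nonempty resolvent set. Then ρ(A) = ρ(A_∞), where A_∞ is the part of A in the Fréchet space D_∞(A) = ∩_k D(A^k). -/
open Set Finset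

/-- `D_∞(A) = ⋂ₖ D(A^k)`. -/
def Dinf {E : Type*} [AddCommGroup E] [Module ℂ E]
    (f : E →ₗ[ℂ] E) (D : Submodule ℂ E) : Set E :=
  ⋂ k : ℕ, (dompowS f D k : Set E)

/-- The graph seminorm `p_k(x) = Σ_{j ≤ k} ‖A^j x‖` of the Fréchet space `D_∞(A)`. -/
noncomputable def graphNorm {E : Type*} [NormedAddCommGroup E] [Module ℂ E]
    (f : E →ₗ[ℂ] E) (k : ℕ) (x : E) : ℝ :=
  ∑ j ∈ Finset.range (k + 1), ‖(f ^ j) x‖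

/-- `lam ∈ ρ(A_∞)`: `lam - A_∞` is a bijection of the Fréchet space `D_∞(A)`
with continuous inverse (with respect to the graph seminorms). -/
def resolventSetInf {E : Type*} [NormedAddCommGroup E] [NormedSpace ℂ E]
    (f : E →ₗ[ℂ] E) (D : Submodule ℂ E) : Set ℂ :=
  {lam | (∀ x ∈ Dinf f D, lam • x - f x = 0 → x = 0) ∧
    (∀ y ∈ Dinf f D, ∃ x ∈ Dinf f D, lam • x - f x = y) ∧
    ∀ k : ℕ, ∃ (m : ℕ) (C : ℝ), 0 < C ∧
      ∀ x ∈ Dinf f D, graphNorm f k x ≤ C * graphNorm f m (lam • x - f x)}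

section Domains

variable {E : Type*} [AddCommGroup E] [Module ℂ E] {f : E →ₗ[ℂ] E} {D : Submodule ℂ E}

theorem dompowS_succ_le_s10 (k : ℕ) : dompowS f D (k + 1) ≤ dompowS f D k := by
  induction k with
  | zero => exact le_top
  | succ k ih => exact fun x hx => ⟨hx.1, ih hx.2⟩

theorem mem_Dinf {x : E} : x ∈ Dinf f D ↔ ∀ k, x ∈ dompowS f D k := by
  simp [Dinf]

theorem mem_domain_of_mem_Dinf {x : E} (hx : x ∈ Dinf f D) : x ∈ D :=
  (mem_Dinf.1 hx 1).1

theorem map_mem_Dinf {x : E} (hx : x ∈ Dinf f D) : f x ∈ Dinf f D :=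
  mem_Dinf.2 fun k => (mem_Dinf.1 hx (k + 1)).2

theorem coe_iInf_dompowS : ((⨅ k, dompowS f D k : Submodule ℂ E) : Set E) = Dinf f D := by
  simp [Dinf]

theorem smul_sub_mem_Dinf (lam : ℂ) {x : E} (hx : x ∈ Dinf f D) :
    lam • x - f x ∈ Dinf f D := by
  have hfx := map_mem_Dinf hx
  rw [← coe_iInf_dompowS] at hx hfx ⊢
  exact Submodule.sub_mem _ (Submodule.smul_mem _ _ hx) hfx

end Domains

theorem norm_le_graphNorm {E : Type*} [NormedAddCommGroup E] [Module ℂ E]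
    (f : E →ₗ[ℂ] E) (k : ℕ) (x : E) : ‖x‖ ≤ graphNorm f k x := by
  have := Finset.single_le_sum (f := fun j => ‖(f ^ j) x‖) (s := Finset.range (k + 1))
    (fun _ _ => norm_nonneg _) (Finset.mem_range.2 k.succ_pos)
  simpa [graphNorm] using this

namespace IsResolvent

variable {E : Type*} [NormedAddCommGroup E] [NormedSpace ℂ E]
  {f : E →ₗ[ℂ] E} {D : Submodule ℂ E} {mu : ℂ} {R : E →L[ℂ] E}

theorem apply_resolvent (hR : IsResolvent f D mu R) (x : E) : f (R x) = mu • R x - x := by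
  rw [eq_sub_iff_add_eq, ← eq_sub_iff_add_eq']
  exact (hR.1 x).2.symm

theorem map_comm (hR : IsResolvent f D mu R) {x : E} (hx : x ∈ D) : f (R x) = R (f x) := by
  have h := hR.2 x hx
  rw [map_sub, map_smul] at h
  rw [hR.apply_resolvent, sub_eq_iff_eq_add', ← sub_eq_iff_eq_add]
  exact h

theorem map_dompowS (hR : IsResolvent f D mu R) {k : ℕ} {x : E} (hx : x ∈ dompowS f D k) :
    R x ∈ dompowS f D (k + 1) := by
  induction k with
  | zero => exact ⟨(hR.1 x).1, trivial⟩
  | succ k ih =>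
    refine ⟨(hR.1 x).1, ?_⟩
    change f (R x) ∈ dompowS f D (k + 1)
    rw [hR.apply_resolvent]
    exact Submodule.sub_mem _ (Submodule.smul_mem _ _ (ih (dompowS_succ_le_s10 k hx))) hx

theorem exists_preimage_dompowS (hR : IsResolvent f D mu R) {k : ℕ} {x : E}
    (hx : x ∈ dompowS f D (k + 1)) : ∃ y ∈ dompowS f D k, R y = x :=
  ⟨mu • x - f x, Submodule.sub_mem _ (Submodule.smul_mem _ _ (dompowS_succ_le_s10 k hx)) hx.2,
    hR.2 x hx.1⟩

theorem map_Dinf (hR : IsResolvent f D mu R) {x : E} (hx : x ∈ Dinf f D) : R x ∈ Dinf f D :=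
  mem_Dinf.2 fun k => dompowS_succ_le_s10 k (hR.map_dompowS (mem_Dinf.1 hx k))

theorem pow_mem_dompowS (hR : IsResolvent f D mu R) (k : ℕ) (x : E) :
    (R ^ k) x ∈ dompowS f D k := by
  induction k with
  | zero => trivial
  | succ k ih =>
    rw [pow_succ']
    exact hR.map_dompowS ih

theorem pow_mem_Dinf (hR : IsResolvent f D mu R) (k : ℕ) {x : E} (hx : x ∈ Dinf f D) :
    (R ^ k) x ∈ Dinf f D := by
  induction k with
  | zero => exact hx
  | succ k ih =>
    rw [pow_succ']
    exact hR.map_Dinf ih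

theorem pow_map_comm (hR : IsResolvent f D mu R) (k : ℕ) {x : E} (hx : x ∈ Dinf f D) :
    f ((R ^ k) x) = (R ^ k) (f x) := by
  induction k with
  | zero => rfl
  | succ k ih =>
    rw [pow_succ']
    change f (R ((R ^ k) x)) = R ((R ^ k) (f x))
    rw [hR.map_comm (mem_domain_of_mem_Dinf (hR.pow_mem_Dinf k hx)), ih]

theorem map_comm_pow (hR : IsResolvent f D mu R) (j : ℕ) {x : E} (hx : x ∈ Dinf f D) :
    (f ^ j) (R x) = R ((f ^ j) x) := by
  induction j generalizing x with
  | zero => rfl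
  | succ j ih =>
    simp only [pow_succ, Module.End.mul_apply]
    rw [hR.map_comm (mem_domain_of_mem_Dinf hx), ih (map_mem_Dinf hx)]

theorem graphNorm_le (hR : IsResolvent f D mu R) (k : ℕ) {x : E} (hx : x ∈ Dinf f D) :
    graphNorm f k (R x) ≤ ‖R‖ * graphNorm f k x := by
  simp only [graphNorm, Finset.mul_sum]
  refine Finset.sum_le_sum fun j _ => ?_
  rw [hR.map_comm_pow j hx]
  exact R.le_opNorm _

theorem exists_clm_pow_comp_pow (hR : IsResolvent f D mu R) {j m : ℕ} (hjm : j ≤ m) :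
    ∃ B : E →L[ℂ] E, ∀ x, (f ^ j) ((R ^ m) x) = B x := by
  induction j generalizing m with
  | zero => exact ⟨R ^ m, fun _ => rfl⟩
  | succ j ih =>
    obtain ⟨m, rfl⟩ : ∃ l, m = l + 1 := ⟨m - 1, by omega⟩
    obtain ⟨B, hB⟩ := ih (m := m + 1) (by omega)
    obtain ⟨B', hB'⟩ := ih (m := m) (by omega)
    refine ⟨mu • B - B', fun x => ?_⟩
    have h : f ((R ^ (m + 1)) x) = mu • (R ^ (m + 1)) x - (R ^ m) x := by
      rw [pow_succ']
      exact hR.apply_resolvent _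
    rw [pow_succ, Module.End.mul_apply, h, map_sub, map_smul, hB, hB']
    rfl

theorem exists_graphNorm_pow_le (hR : IsResolvent f D mu R) (m : ℕ) :
    ∃ C : ℝ, ∀ x, graphNorm f m ((R ^ m) x) ≤ C * ‖x‖ := by
  choose! B hB using fun j (hj : j ≤ m) => hR.exists_clm_pow_comp_pow hj
  refine ⟨∑ j ∈ Finset.range (m + 1), ‖B j‖, fun x => ?_⟩
  rw [graphNorm, Finset.sum_mul]
  refine Finset.sum_le_sum fun j hj => ?_
  rw [hB j (Nat.lt_succ_iff.1 (Finset.mem_range.1 hj))]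
  exact (B j).le_opNorm x

/-- If the resolvent set contains a point, `D_∞(A)` is dense in `D(A^n)` for every `n` past which
each `D(A^m)` lies in the closure of `D(A^(m+1))`. -/
theorem dompowS_subset_closure_Dinf [CompleteSpace E] (hR : IsResolvent f D mu R) {n : ℕ}
    (hn : (dompowS f D n : Set E) ⊆ closure (dompowS f D (n + 1) : Set E)) :
    (dompowS f D n : Set E) ⊆ closure (Dinf f D) := by
  intro x hx
  rw [Metric.mem_closure_iff]
  intro ε hε
  let M : ℝ := max 1 ‖R‖
  have hM1 : 1 ≤ M := le_max_left _ _
  have hpow : ∀ i z, ‖(R ^ i) z‖ ≤ M ^ i * ‖z‖ := fun i z => by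
    induction i with
    | zero => simp
    | succ i ih =>
      rw [pow_succ', pow_succ', mul_assoc]
      exact (R.le_opNorm _).trans
        (mul_le_mul (le_max_right _ _) ih (norm_nonneg _) (by positivity))
  have step : ∀ (k : ℕ) (v : dompowS f D n), ∃ w : dompowS f D n,
      dist (v : E) (R w) < ε / 4 / 2 ^ k / M ^ k := fun k v => by
    obtain ⟨y, hy, hd⟩ := Metric.mem_closure_iff.1 (hn v.2) (ε / 4 / 2 ^ k / M ^ k) (by positivity)
    obtain ⟨w, hw, rfl⟩ := hR.exists_preimage_dompowS hy
    exact ⟨⟨w, hw⟩, hd⟩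
  choose next hnext using step
  let v : ℕ → dompowS f D n := fun k =>
    Nat.rec (motive := fun _ => dompowS f D n) ⟨x, hx⟩ next k
  have hv : ∀ k, dist (v k : E) (R (v (k + 1))) < ε / 4 / 2 ^ k / M ^ k := fun k => hnext k (v k)
  have hd : ∀ j i, dist ((R ^ i) (v (i + j) : E)) ((R ^ (i + 1)) (v (i + 1 + j) : E))
      ≤ ε / 2 / 2 / 2 ^ i := fun j i => by
    have h1 := hv (i + j)
    rw [dist_eq_norm] at h1
    have h2 : (R ^ (i + 1)) (v (i + 1 + j) : E) = (R ^ i) (R (v (i + j + 1))) := by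
      rw [pow_succ, add_right_comm]; rfl
    rw [h2, dist_eq_norm, ← map_sub]
    refine (hpow _ _).trans ((mul_le_mul_of_nonneg_left h1.le (by positivity)).trans ?_)
    have h3 : M ^ i ≤ M ^ (i + j) := pow_le_pow_right₀ hM1 (Nat.le_add_right _ _)
    have h4 : (2 : ℝ) ^ i ≤ 2 ^ (i + j) := pow_le_pow_right₀ one_le_two (Nat.le_add_right _ _)
    calc M ^ i * (ε / 4 / 2 ^ (i + j) / M ^ (i + j))
        ≤ M ^ (i + j) * (ε / 4 / 2 ^ (i + j) / M ^ (i + j)) := by gcongr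
      _ = ε / 4 / 2 ^ (i + j) := by field_simp
      _ ≤ ε / 4 / 2 ^ i := by gcongr
      _ = ε / 2 / 2 / 2 ^ i := by ring
  choose z hz using fun j => cauchySeq_tendsto_of_complete (cauchySeq_of_le_geometric_two (hd j))
  have hzR : ∀ j, z j = R (z (j + 1)) := fun j => by
    refine tendsto_nhds_unique ((Filter.tendsto_add_atTop_iff_nat 1).2 (hz j)) ?_
    refine ((R.continuous.tendsto _).comp (hz (j + 1))).congr fun i => ?_
    rw [Function.comp_apply, pow_succ', add_right_comm, add_assoc]; rfl
  have hz_mem : ∀ k j, z j ∈ dompowS f D k := fun k => by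
    induction k with
    | zero => exact fun _ => trivial
    | succ k ih =>
      intro j
      rw [hzR]
      exact hR.map_dompowS (ih _)
  refine ⟨z 0, mem_Dinf.2 fun k => hz_mem k 0, ?_⟩
  exact lt_of_le_of_lt (dist_le_of_le_geometric_two_of_tendsto₀ (hd 0) (hz 0)) (half_lt_self hε)

theorem mem_resolventSetInf {lam : ℂ} (hR : IsResolvent f D lam R) :
    lam ∈ resolventSetInf f D := by
  refine ⟨fun x hx h => ?_, fun y hy => ⟨R y, hR.map_Dinf hy, (hR.1 y).2⟩, fun k =>
    ⟨k, ‖R‖ + 1, by positivity, fun x hx => ?_⟩⟩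
  · rw [← hR.2 x (mem_domain_of_mem_Dinf hx), h, map_zero]
  · have h := hR.graphNorm_le k (smul_sub_mem_Dinf lam hx)
    rw [hR.2 x (mem_domain_of_mem_Dinf hx)] at h
    refine h.trans (mul_le_mul_of_nonneg_right (by linarith) ?_)
    exact (norm_nonneg _).trans (norm_le_graphNorm f k _)

theorem eq_resolvent_sub (hR : IsResolvent f D mu R) (lam : ℂ) {x : E} (hx : x ∈ D) :
    x = R (lam • x - f x) - (lam - mu) • R x := by
  conv_lhs => rw [← hR.2 x hx]
  rw [← map_smul, ← map_sub]
  congr 1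
  module

/-- A graph-seminorm bound for the inverse of `lam - A_∞` improves to a bound in the norm of the
ambient space. -/
theorem exists_norm_le (hR : IsResolvent f D mu R) {lam : ℂ}
    (hlam : lam ∈ resolventSetInf f D) :
    ∃ C : ℝ, ∀ x ∈ Dinf f D, ‖x‖ ≤ C * ‖lam • x - f x‖ := by
  obtain ⟨m, C, hC, hmC⟩ := hlam.2.2 0
  obtain ⟨C', hC'⟩ := hR.exists_graphNorm_pow_le m
  have key : ∀ i ≤ m, ∃ K : ℝ, ∀ x ∈ Dinf f D, ‖(R ^ i) x‖ ≤ K * ‖lam • x - f x‖ := by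
    intro i hi
    induction hi using Nat.decreasingInduction with
    | self =>
      refine ⟨C * C', fun x hx => ?_⟩
      have h := hmC _ (hR.pow_mem_Dinf m hx)
      rw [hR.pow_map_comm m hx, ← map_smul, ← map_sub] at h
      refine (norm_le_graphNorm f 0 _).trans (h.trans ?_)
      rw [mul_assoc]
      exact mul_le_mul_of_nonneg_left (hC' _) hC.le
    | of_succ i hi ih =>
      obtain ⟨K, hK⟩ := ih
      refine ⟨‖R ^ (i + 1)‖ + ‖lam - mu‖ * K, fun x hx => ?_⟩
      have h : (R ^ i) x = (R ^ (i + 1)) (lam • x - f x) - (lam - mu) • (R ^ (i + 1)) x := by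
        conv_lhs => rw [hR.eq_resolvent_sub lam (mem_domain_of_mem_Dinf hx), map_sub, map_smul]
        rw [pow_succ]; rfl
      rw [h, add_mul, mul_assoc]
      refine (norm_sub_le _ _).trans (add_le_add ((R ^ (i + 1)).le_opNorm _) ?_)
      rw [norm_smul]
      exact mul_le_mul_of_nonneg_left (hK x hx) (norm_nonneg _)
  simpa using key 0 (Nat.zero_le _)

theorem mem_Dinf_of_smul_sub_eq_zero (hR : IsResolvent f D mu R) {lam : ℂ} {x : E} (hx : x ∈ D)
    (h : lam • x - f x = 0) : x ∈ Dinf f D := by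
  refine mem_Dinf.2 fun k => ?_
  induction k with
  | zero => trivial
  | succ k ih =>
    rw [hR.eq_resolvent_sub lam hx, h, map_zero, zero_sub]
    exact Submodule.neg_mem _ (Submodule.smul_mem _ _ (hR.map_dompowS ih))

/-- The inverse of `lam - A_∞` extends to a bounded right inverse of `lam - A` on the closure of
`D_∞(A)`. -/
theorem exists_clm_closure [CompleteSpace E] (hR : IsResolvent f D mu R) (hA : IsClosedOp f D)
    {lam : ℂ} (hlam : lam ∈ resolventSetInf f D) :
    ∃ S : (⨅ k, dompowS f D k : Submodule ℂ E).topologicalClosure →L[ℂ] E,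
      ∀ v, S v ∈ D ∧ lam • S v - f (S v) = v := by
  set P : Submodule ℂ E := ⨅ k, dompowS f D k
  have hP : ∀ {x}, x ∈ P ↔ x ∈ Dinf f D := fun {x} => by
    rw [← coe_iInf_dompowS]; rfl
  let e : P →ₗ[ℂ] P.topologicalClosure :=
    ((lam • LinearMap.id - f).comp P.subtype).codRestrict _ fun x =>
      P.le_topologicalClosure (hP.2 (smul_sub_mem_Dinf lam (hP.1 x.2)))
  have he : ∀ x, (e x : E) = lam • (x : E) - f x := fun _ => rfl
  have hdense : DenseRange e := by
    refine Dense.mono ?_ ((denseRange_inclusion_iff (s := (P : Set E))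
      (t := (P.topologicalClosure : Set E)) P.le_topologicalClosure).2 subset_rfl)
    rintro _ ⟨y, rfl⟩
    obtain ⟨x, hx, hxy⟩ := hlam.2.1 y (hP.1 y.2)
    exact ⟨⟨x, hP.2 hx⟩, Subtype.ext hxy⟩
  obtain ⟨C, hC⟩ := hR.exists_norm_le hlam
  let S := P.subtype.extendOfNorm e
  have hS : ∀ x, S (e x) = x := fun x =>
    LinearMap.extendOfNorm_eq hdense ⟨C, fun x => hC x (hP.1 x.2)⟩ x
  refine ⟨S, fun v => ?_⟩
  have hv : S v ∈ D ∧ f (S v) = lam • S v - v := by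
    refine isClosed_property (p := fun v => S v ∈ D ∧ f (S v) = lam • S v - (v : E)) hdense
      (hA.preimage (f := fun v => (S v, lam • S v - (v : E))) (by fun_prop)) (fun x => ?_) v
    rw [hS, he]
    exact ⟨mem_domain_of_mem_Dinf (hP.1 x.2), by abel⟩
  exact ⟨hv.1, by rw [hv.2]; abel⟩

theorem exists_resolvent_of_mem_resolventSetInf [CompleteSpace E] (hR : IsResolvent f D mu R)
    (hA : IsClosedOp f D) {n : ℕ}
    (hn : (dompowS f D n : Set E) ⊆ closure (dompowS f D (n + 1) : Set E))
    {lam : ℂ} (hlam : lam ∈ resolventSetInf f D) :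
    ∃ T : E →L[ℂ] E, IsResolvent f D lam T := by
  obtain ⟨S, hS⟩ := hR.exists_clm_closure hA hlam
  have key : ∀ i ≤ n, ∃ G : E →L[ℂ] E, ∀ x, G x ∈ D ∧ lam • G x - f (G x) = (R ^ i) x := by
    intro i hi
    induction hi using Nat.decreasingInduction with
    | self =>
      refine ⟨S.comp ((R ^ n).codRestrict _ fun x => ?_), fun x => hS _⟩
      rw [← SetLike.mem_coe, Submodule.topologicalClosure_coe, coe_iInf_dompowS]
      exact hR.dompowS_subset_closure_Dinf hn (hR.pow_mem_dompowS n x)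
    | of_succ i hi ih =>
      obtain ⟨G, hG⟩ := ih
      refine ⟨R ^ (i + 1) - (lam - mu) • G, fun x => ?_⟩
      have hRi : (R ^ (i + 1)) x = R ((R ^ i) x) := by rw [pow_succ']; rfl
      have hGx := (hG x).2
      rw [hRi, sub_eq_iff_eq_add', ← sub_eq_iff_eq_add] at hGx
      simp only [sub_apply, FunLike.coe_smul, Pi.smul_apply, hRi]
      refine ⟨Submodule.sub_mem _ (hR.1 _).1 (Submodule.smul_mem _ _ (hG x).1), ?_⟩
      rw [map_sub, map_smul, hR.apply_resolvent, ← hGx]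
      module
  obtain ⟨T, hT⟩ := key 0 (Nat.zero_le _)
  refine ⟨T, hT, fun x hx => ?_⟩
  have hmem : T (lam • x - f x) - x ∈ D := Submodule.sub_mem _ (hT _).1 hx
  have hzero : lam • (T (lam • x - f x) - x) - f (T (lam • x - f x) - x) = 0 := by
    have h : lam • T (lam • x - f x) - f (T (lam • x - f x)) = lam • x - f x :=
      (hT (lam • x - f x)).2
    rw [smul_sub, map_sub f, sub_sub_sub_comm, h, sub_self]
  exact sub_eq_zero.1 (hlam.1 _ (hR.mem_Dinf_of_smul_sub_eq_zero hmem hzero) hzero)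

end IsResolvent

/-- For a stationary dense closed operator `A` on a Banach space with nonempty resolvent
set, `ρ(A) = ρ(A_∞)`, where `A_∞` is the part of `A` in `D_∞(A)`. -/
theorem stmt10 {E : Type*} [NormedAddCommGroup E] [NormedSpace ℂ E] [CompleteSpace E]
    (f : E →ₗ[ℂ] E) (D : Submodule ℂ E) (hA : IsClosedOp f D)
    (hstat : (statSet f D).Nonempty)
    (hres : {lam : ℂ | ∃ R : E →L[ℂ] E, IsResolvent f D lam R}.Nonempty) :
    {lam : ℂ | ∃ R : E →L[ℂ] E, IsResolvent f D lam R} = resolventSetInf f D := by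
  obtain ⟨n, hn⟩ := hstat
  obtain ⟨mu, R, hR⟩ := hres
  ext lam
  exact ⟨fun ⟨_, hT⟩ => hT.mem_resolventSetInf,
    hR.exists_resolvent_of_mem_resolventSetInf hA (hn n le_rfl)⟩
end

section
/- Let T ∈ SE'_a(ℝ, E) be an E-valued tempered distribution of exponential type a ≥ 0 (i.e., e^{−a·}T ∈ S'(ℝ, E)). Then there exist a polynomial differential operator P(d/dt), a continuous function g : ℝ → E, and constants C, k > 0 such that e^{−ax} ‖g(x)‖ ≤ C |x|^k for all x and T = P(d/dt) g in the distributional sense. -/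
open Set MeasureTheory Finset

open Filter Topology SchwartzMap

theorem SchwartzMap.integrable_one_add_abs_pow_mul (φ : 𝓢(ℝ, ℂ)) (k : ℕ) :
    Integrable (fun t : ℝ => (1 + |t|) ^ k * ‖φ t‖) := by
  have h : (fun t : ℝ => (1 + |t|) ^ k * ‖φ t‖) =
      fun t => ∑ i ∈ Finset.range (k + 1), (k.choose i : ℝ) * (‖t‖ ^ i * ‖φ t‖) := by
    ext t
    rw [add_comm, add_pow, Finset.sum_mul]
    refine Finset.sum_congr rfl fun i _ => ?_
    simp only [one_pow, mul_one, Real.norm_eq_abs]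
    ring
  rw [h]
  exact integrable_finsetSum _ fun i _ => (φ.integrable_pow_mul volume i).const_mul _

theorem SchwartzMap.one_add_abs_pow_mul_norm_le_integral (φ : 𝓢(ℝ, ℂ)) (k : ℕ) (x : ℝ) :
    (1 + |x|) ^ k * ‖φ x‖ ≤ ∫ t : ℝ, (1 + |t|) ^ k * ‖derivCLM ℂ ℂ φ t‖ := by
  have hint := (derivCLM ℂ ℂ φ).integrable_one_add_abs_pow_mul k
  have hd : Integrable (derivCLM ℂ ℂ φ) := (derivCLM ℂ ℂ φ).integrable
  have hlim := φ.tendsto_cocompact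
  rw [cocompact_eq_atBot_atTop] at hlim
  have key : ∀ s : Set ℝ, MeasurableSet s → (∀ t ∈ s, |x| ≤ |t|) →
      ‖φ x‖ = ‖∫ t in s, derivCLM ℂ ℂ φ t‖ →
      (1 + |x|) ^ k * ‖φ x‖ ≤ ∫ t : ℝ, (1 + |t|) ^ k * ‖derivCLM ℂ ℂ φ t‖ := by
    intro s hs hst hφ
    rw [hφ]
    calc (1 + |x|) ^ k * ‖∫ t in s, derivCLM ℂ ℂ φ t‖
        ≤ (1 + |x|) ^ k * ∫ t in s, ‖derivCLM ℂ ℂ φ t‖ := by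
          gcongr
          exact norm_integral_le_integral_norm _
      _ = ∫ t in s, (1 + |x|) ^ k * ‖derivCLM ℂ ℂ φ t‖ := (integral_const_mul _ _).symm
      _ ≤ ∫ t in s, (1 + |t|) ^ k * ‖derivCLM ℂ ℂ φ t‖ := by
          refine setIntegral_mono_on (hd.norm.const_mul _).integrableOn hint.integrableOn hs ?_
          intro t ht
          have := hst t ht
          gcongr
      _ ≤ _ := setIntegral_le_integral hint (Eventually.of_forall fun t => by positivity)
  rcases le_total 0 x with hx | hx
  · refine key (Ioi x) measurableSet_Ioi (fun t ht => ?_) ?_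
    · rw [abs_of_nonneg hx, abs_of_nonneg (hx.trans (le_of_lt ht))]
      exact le_of_lt ht
    · have := integral_Ioi_of_hasDerivAt_of_tendsto' (a := x) (f' := derivCLM ℂ ℂ φ)
        (fun t _ => φ.hasDerivAt t) hd.integrableOn (hlim.mono_left le_sup_right)
      rw [this, zero_sub, norm_neg]
  · refine key (Iic x) measurableSet_Iic (fun t ht => ?_) ?_
    · rw [abs_of_nonpos hx, abs_of_nonpos (le_trans ht hx)]
      exact neg_le_neg ht
    · have := integral_Iic_of_hasDerivAt_of_tendsto' (a := x) (f' := derivCLM ℂ ℂ φ)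
        (fun t _ => φ.hasDerivAt t) hd.integrableOn (hlim.mono_left le_sup_left)
      rw [this, sub_zero]

theorem integrable_one_add_abs_inv_sq : Integrable (fun t : ℝ => ((1 + |t|) ^ 2)⁻¹) := by
  have := integrable_one_add_norm (E := ℝ) (μ := volume) (r := 2) (by simp)
  refine this.congr (Eventually.of_forall fun t => ?_)
  simp only [Real.norm_eq_abs]
  rw [Real.rpow_neg (by positivity)]
  norm_cast

theorem SchwartzMap.integral_one_add_abs_pow_mul_le (φ : 𝓢(ℝ, ℂ)) (k : ℕ) :
    ∫ t : ℝ, (1 + |t|) ^ k * ‖φ t‖ ≤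
      (∫ t : ℝ, ((1 + |t|) ^ 2)⁻¹) * ∫ t : ℝ, (1 + |t|) ^ (k + 2) * ‖derivCLM ℂ ℂ φ t‖ := by
  rw [← integral_mul_const]
  refine integral_mono (φ.integrable_one_add_abs_pow_mul k)
    (integrable_one_add_abs_inv_sq.mul_const _) fun t => ?_
  have h := φ.one_add_abs_pow_mul_norm_le_integral (k + 2) t
  have hp : 0 < (1 + |t|) ^ 2 := by positivity
  rw [pow_add] at h
  dsimp only
  rw [inv_mul_eq_div, le_div_iff₀ hp]
  linarith

theorem SchwartzMap.exists_integral_le_iterate_deriv (k n : ℕ) : ∃ C : ℝ, 0 ≤ C ∧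
    ∀ φ : 𝓢(ℝ, ℂ), ∫ t : ℝ, (1 + |t|) ^ k * ‖φ t‖ ≤
      C * ∫ t : ℝ, (1 + |t|) ^ (k + 2 * n) * ‖((derivCLM ℂ ℂ)^[n] φ) t‖ := by
  induction n generalizing k with
  | zero => exact ⟨1, zero_le_one, fun φ => by simp⟩
  | succ n ih =>
    obtain ⟨C, hC, h⟩ := ih (k + 2)
    have hA : 0 ≤ ∫ t : ℝ, ((1 + |t|) ^ 2)⁻¹ := integral_nonneg fun t => by positivity
    refine ⟨(∫ t : ℝ, ((1 + |t|) ^ 2)⁻¹) * C, by positivity, fun φ => ?_⟩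
    refine (φ.integral_one_add_abs_pow_mul_le k).trans ?_
    rw [mul_assoc]
    refine mul_le_mul_of_nonneg_left ?_ hA
    have := h (derivCLM ℂ ℂ φ)
    rwa [← Function.iterate_succ_apply, show k + 2 + 2 * n = k + 2 * (n + 1) by ring] at this

theorem SchwartzMap.coe_iterate_derivCLM (φ : 𝓢(ℝ, ℂ)) (n : ℕ) :
    ⇑((derivCLM ℂ ℂ)^[n] φ) = iteratedDeriv n φ := by
  induction n with
  | zero => simp
  | succ n ih =>
    rw [Function.iterate_succ_apply', iteratedDeriv_succ, ← ih]
    rfl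

theorem SchwartzMap.exists_seminorm_le_integral (k l n K : ℕ) (hl : l + 1 ≤ n)
    (hK : k + 2 * n ≤ K) :
    ∃ C : ℝ, 0 ≤ C ∧ ∀ φ : 𝓢(ℝ, ℂ), SchwartzMap.seminorm ℂ k l φ ≤
      C * ∫ t : ℝ, (1 + |t|) ^ K * ‖((derivCLM ℂ ℂ)^[n] φ) t‖ := by
  obtain ⟨d, rfl⟩ := Nat.exists_eq_add_of_le hl
  obtain ⟨C, hC, h⟩ := exists_integral_le_iterate_deriv k d
  have hnn : ∀ (j : ℕ) (φ : 𝓢(ℝ, ℂ)), 0 ≤ ∫ t : ℝ, (1 + |t|) ^ j * ‖φ t‖ :=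
    fun j φ => integral_nonneg fun t => by positivity
  refine ⟨C, hC, fun φ => seminorm_le_bound' ℂ k l φ (mul_nonneg hC (hnn _ _)) fun x => ?_⟩
  rw [← coe_iterate_derivCLM]
  calc |x| ^ k * ‖((derivCLM ℂ ℂ)^[l] φ) x‖
      ≤ (1 + |x|) ^ k * ‖((derivCLM ℂ ℂ)^[l] φ) x‖ := by gcongr; linarith
    _ ≤ ∫ t : ℝ, (1 + |t|) ^ k * ‖((derivCLM ℂ ℂ)^[l + 1] φ) t‖ := by
        rw [Function.iterate_succ_apply']
        exact one_add_abs_pow_mul_norm_le_integral _ k x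
    _ ≤ C * ∫ t : ℝ, (1 + |t|) ^ (k + 2 * d) * ‖((derivCLM ℂ ℂ)^[l + 1 + d] φ) t‖ := by
        rw [add_comm (l + 1) d, Function.iterate_add_apply _ d (l + 1)]
        exact h _
    _ ≤ _ := by
        refine mul_le_mul_of_nonneg_left (integral_mono
          (integrable_one_add_abs_pow_mul _ _) (integrable_one_add_abs_pow_mul _ _)
          fun t => ?_) hC
        dsimp only
        gcongr
        · linarith [abs_nonneg t]
        · omega

/-- Lebesgue measure on `ℝ` with the polynomial density `(1 + |x|) ^ r`. -/
noncomputable def polyVolume (r : ℕ) : Measure ℝ :=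
  volume.withDensity fun x => ENNReal.ofReal ((1 + |x|) ^ r)

theorem measurable_ofReal_one_add_abs_pow (r : ℕ) :
    Measurable fun x : ℝ => ENNReal.ofReal ((1 + |x|) ^ r) := by fun_prop

theorem integrable_polyVolume_iff {F : Type*} [NormedAddCommGroup F] [NormedSpace ℝ F] {r : ℕ}
    {f : ℝ → F} :
    Integrable f (polyVolume r) ↔ Integrable (fun x => (1 + |x|) ^ r • f x) := by
  rw [polyVolume, integrable_withDensity_iff_integrable_smul'
    (measurable_ofReal_one_add_abs_pow r) (by simp)]
  have : ∀ x : ℝ, (0 : ℝ) ≤ (1 + |x|) ^ r := fun x => by positivity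
  simp only [ENNReal.toReal_ofReal (this _)]

theorem integral_polyVolume {F : Type*} [NormedAddCommGroup F] [NormedSpace ℝ F] {r : ℕ}
    (f : ℝ → F) : ∫ x, f x ∂(polyVolume r) = ∫ x : ℝ, (1 + |x|) ^ r • f x := by
  rw [polyVolume, integral_withDensity_eq_integral_toReal_smul
    (measurable_ofReal_one_add_abs_pow r) (by simp)]
  have : ∀ x : ℝ, (0 : ℝ) ≤ (1 + |x|) ^ r := fun x => by positivity
  simp only [ENNReal.toReal_ofReal (this _)]

theorem integrable_polyVolume_inv_pow (r : ℕ) :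
    Integrable (fun x : ℝ => ((1 + |x|) ^ (r + 2))⁻¹) (polyVolume r) := by
  rw [integrable_polyVolume_iff]
  refine integrable_one_add_abs_inv_sq.congr (Eventually.of_forall fun t => ?_)
  have : (1 + |t|) ≠ 0 := by positivity
  simp only [smul_eq_mul]
  field_simp
  ring

instance (r : ℕ) : (polyVolume r).HasTemperateGrowth where
  exists_integrable := by
    refine ⟨r + 2, (integrable_polyVolume_inv_pow r).congr (Eventually.of_forall fun t => ?_)⟩
    simp only [Real.norm_eq_abs]
    rw [Real.rpow_neg (by positivity)]
    norm_cast

instance (r : ℕ) : IsLocallyFiniteMeasure (polyVolume r) :=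
  IsLocallyFiniteMeasure.withDensity_ofReal (by fun_prop)

instance (r : ℕ) : SFinite (polyVolume r) := by
  unfold polyVolume; infer_instance

theorem SchwartzMap.exists_integral_le_norm_toLp (K : ℕ) : ∃ C : ℝ, 0 ≤ C ∧ ∀ φ : 𝓢(ℝ, ℂ),
    ∫ t : ℝ, (1 + |t|) ^ K * ‖φ t‖ ≤ C * ‖φ.toLp 2 (polyVolume (2 * K + 2))‖ := by
  refine ⟨(∫ t : ℝ, ((1 + |t|)⁻¹) ^ (2 : ℝ)) ^ (1 / (2 : ℝ)), by positivity, fun φ => ?_⟩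
  have h1 : MemLp (fun t : ℝ => (1 + |t|)⁻¹) (ENNReal.ofReal 2) := by
    rw [ENNReal.ofReal_ofNat, memLp_two_iff_integrable_sq (by fun_prop)]
    simpa only [inv_pow] using integrable_one_add_abs_inv_sq
  have hφ := φ.memLp 2 (polyVolume (2 * K + 2))
  have h2 : MemLp (fun t : ℝ => (1 + |t|) ^ (K + 1) * ‖φ t‖) (ENNReal.ofReal 2) := by
    have hc := φ.continuous
    rw [ENNReal.ofReal_ofNat, memLp_two_iff_integrable_sq (by fun_prop)]
    rw [memLp_two_iff_integrable_sq_norm hφ.1, integrable_polyVolume_iff] at hφ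
    refine hφ.congr (Eventually.of_forall fun t => ?_)
    simp only [smul_eq_mul]
    ring
  have := integral_mul_le_Lp_mul_Lq_of_nonneg (μ := volume) Real.HolderConjugate.two_two
    (Eventually.of_forall fun t : ℝ => show 0 ≤ (1 + |t|)⁻¹ by positivity)
    (Eventually.of_forall fun t : ℝ => show 0 ≤ (1 + |t|) ^ (K + 1) * ‖φ t‖ by positivity) h1 h2
  have hnorm : ‖φ.toLp 2 (polyVolume (2 * K + 2))‖ =
      (∫ t : ℝ, ((1 + |t|) ^ (K + 1) * ‖φ t‖) ^ (2 : ℝ)) ^ (1 / (2 : ℝ)) := by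
    rw [norm_toLp' (by simp) (by simp), integral_polyVolume]
    simp only [ENNReal.toReal_ofNat, Real.rpow_ofNat, smul_eq_mul, one_div]
    congr 2
    ext t
    ring
  rw [hnorm]
  refine le_of_eq_of_le (integral_congr_ae (Eventually.of_forall fun t => ?_)) this
  have : (1 + |t|) ≠ 0 := by positivity
  dsimp only
  field_simp
  ring

theorem SchwartzMap.exists_norm_apply_le {E : Type*} [NormedAddCommGroup E] [NormedSpace ℂ E]
    (T : 𝓢(ℝ, ℂ) →L[ℂ] E) : ∃ (r n : ℕ) (C : ℝ), ∀ φ : 𝓢(ℝ, ℂ),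
      ‖T φ‖ ≤ C * ‖((derivCLM ℂ ℂ)^[n] φ).toLp 2 (polyVolume r)‖ := by
  obtain ⟨s, C, -, hC⟩ := Seminorm.bound_of_continuous (schwartz_withSeminorms ℂ ℝ ℂ)
    ((normSeminorm ℂ E).comp T.toLinearMap) (continuous_norm.comp T.continuous)
  set n := s.sup Prod.snd + 1 with hn
  set K := s.sup Prod.fst + 2 * n with hK
  obtain ⟨C₁, hC₁, h₁⟩ := exists_integral_le_norm_toLp K
  have hs : ∀ i ∈ s, ∃ B : ℝ, 0 ≤ B ∧ ∀ φ : 𝓢(ℝ, ℂ), SchwartzMap.seminorm ℂ i.1 i.2 φ ≤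
      B * ∫ t : ℝ, (1 + |t|) ^ K * ‖((derivCLM ℂ ℂ)^[n] φ) t‖ := fun i hi =>
    exists_seminorm_le_integral i.1 i.2 n K
      (Nat.succ_le_succ (Finset.le_sup (f := Prod.snd) hi))
      (Nat.add_le_add_right (Finset.le_sup (f := Prod.fst) hi) _)
  choose! B hB h₂ using hs
  refine ⟨2 * K + 2, n, C * ((∑ i ∈ s, B i) * C₁), fun φ => ?_⟩
  have hI : 0 ≤ ∫ t : ℝ, (1 + |t|) ^ K * ‖((derivCLM ℂ ℂ)^[n] φ) t‖ :=
    integral_nonneg fun t => by positivity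
  have hS : 0 ≤ ∑ i ∈ s, B i := Finset.sum_nonneg hB
  calc ‖T φ‖ ≤ C * (s.sup (schwartzSeminormFamily ℂ ℝ ℂ)) φ := hC φ
    _ ≤ C * ((∑ i ∈ s, B i) * ∫ t : ℝ, (1 + |t|) ^ K * ‖((derivCLM ℂ ℂ)^[n] φ) t‖) := by
        gcongr
        refine Seminorm.finset_sup_apply_le (mul_nonneg hS hI) fun i hi => ?_
        refine (h₂ i hi φ).trans ?_
        gcongr
        exact Finset.single_le_sum hB hi
    _ ≤ C * ((∑ i ∈ s, B i) * (C₁ * ‖((derivCLM ℂ ℂ)^[n] φ).toLp 2 _‖)) := by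
        gcongr
        exact h₁ _
    _ = _ := by ring

theorem SchwartzMap.exists_factor_toLp {E : Type*} [NormedAddCommGroup E] [NormedSpace ℂ E]
    [CompleteSpace E] (T : 𝓢(ℝ, ℂ) →L[ℂ] E) :
    ∃ (r n : ℕ) (S : Lp ℂ 2 (polyVolume r) →L[ℂ] E), ∀ φ : 𝓢(ℝ, ℂ),
      T φ = S (((derivCLM ℂ ℂ)^[n] φ).toLp 2 (polyVolume r)) := by
  obtain ⟨r, n, C, h⟩ := exists_norm_apply_le T
  let J : 𝓢(ℝ, ℂ) →ₗ[ℂ] Lp ℂ 2 (polyVolume r) :=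
    (toLpCLM ℂ ℂ 2 (polyVolume r)).toLinearMap ∘ₗ
      ((derivCLM ℂ ℂ).toLinearMap : Module.End ℂ 𝓢(ℝ, ℂ)) ^ n
  have hJ : ∀ φ, J φ = ((derivCLM ℂ ℂ)^[n] φ).toLp 2 (polyVolume r) := fun φ => by
    simp [J, Module.End.pow_apply]
  let V := (LinearMap.range J).topologicalClosure
  let e : 𝓢(ℝ, ℂ) →ₗ[ℂ] V :=
    J.codRestrict V fun φ => Submodule.le_topologicalClosure _ (LinearMap.mem_range_self J φ)
  have he : DenseRange e := by
    rintro ⟨y, hy⟩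
    rw [closure_subtype, ← Set.range_comp]
    exact hy
  have : CompleteSpace V :=
    (Submodule.isClosed_topologicalClosure (LinearMap.range J)).completeSpace_coe
  refine ⟨r, n, (T.toLinearMap.extendOfNorm e) ∘L V.orthogonalProjectionOnto, fun φ => ?_⟩
  have h1 : V.orthogonalProjectionOnto (J φ) = e φ :=
    Submodule.orthogonalProjectionOnto_mem_subspace_eq_self (e φ)
  rw [← hJ, ContinuousLinearMap.comp_apply, h1, LinearMap.extendOfNorm_eq he]
  · rfl
  · exact ⟨C, fun φ => by simpa [e, hJ] using h φ⟩

theorem integrable_schwartz_smul {F : Type*} [NormedAddCommGroup F] [NormedSpace ℂ F]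
    (φ : 𝓢(ℝ, ℂ)) {h : ℝ → F} (hc : Continuous h) {C : ℝ} {n : ℕ}
    (hb : ∀ x, ‖h x‖ ≤ C * (1 + |x|) ^ n) : Integrable (fun x => φ x • h x) := by
  refine ((φ.integrable_one_add_abs_pow_mul n).const_mul C).mono'
    (φ.continuous.smul hc).aestronglyMeasurable (Eventually.of_forall fun x => ?_)
  rw [norm_smul]
  calc ‖φ x‖ * ‖h x‖ ≤ ‖φ x‖ * (C * (1 + |x|) ^ n) := by gcongr; exact hb x
    _ = _ := by ring

theorem polyVolume_uIoc_le (r : ℕ) (x y : ℝ) :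
    polyVolume r (Set.uIoc x y) ≤ ENNReal.ofReal ((1 + max |x| |y|) ^ r * |y - x|) := by
  rw [polyVolume, withDensity_apply _ measurableSet_uIoc, ENNReal.ofReal_mul (by positivity)]
  calc ∫⁻ a in Set.uIoc x y, ENNReal.ofReal ((1 + |a|) ^ r)
      ≤ ∫⁻ _ in Set.uIoc x y, ENNReal.ofReal ((1 + max |x| |y|) ^ r) := by
        refine setLIntegral_mono measurable_const fun a ha => ?_
        gcongr
        rw [Set.mem_uIoc] at ha
        rcases ha with ha | ha
        · exact abs_le_max_abs_abs ha.1.le ha.2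
        · rw [max_comm]
          exact abs_le_max_abs_abs ha.1.le ha.2
    _ = _ := by rw [setLIntegral_const, Real.volume_uIoc]

theorem polyVolume_Ioc_ne_top (r : ℕ) (x y : ℝ) : polyVolume r (Set.Ioc x y) ≠ ⊤ :=
  measure_Ioc_lt_top.ne

theorem norm_indicatorConstLp_polyVolume_le (r : ℕ) (x : ℝ) {s : Set ℝ} (hs : MeasurableSet s)
    (hμ : polyVolume r s ≠ ⊤) (hsub : s ⊆ Set.uIoc 0 x) :
    ‖indicatorConstLp (μ := polyVolume r) 2 hs hμ (1 : ℂ)‖ ≤ (1 + |x|) ^ (r + 1) := by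
  refine norm_indicatorConstLp_le.trans ?_
  have h0 : (polyVolume r).real s ≤ (1 + |x|) ^ (r + 1) := by
    refine ENNReal.toReal_le_of_le_ofReal (by positivity)
      ((measure_mono hsub).trans ((polyVolume_uIoc_le r 0 x).trans ?_))
    rw [abs_zero, max_eq_right (abs_nonneg x), sub_zero, pow_succ]
    gcongr
    linarith
  have h1 : (1 : ℝ) ≤ (1 + |x|) ^ (r + 1) := one_le_pow₀ (by linarith [abs_nonneg x])
  rw [norm_one, one_mul]
  calc (polyVolume r).real s ^ (1 / (2 : ENNReal).toReal)
      ≤ ((1 + |x|) ^ (r + 1)) ^ (1 / (2 : ENNReal).toReal) := by gcongr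
    _ ≤ ((1 + |x|) ^ (r + 1)) ^ (1 : ℝ) := by
        refine Real.rpow_le_rpow_of_exponent_le h1 ?_
        norm_num
    _ = _ := Real.rpow_one _

theorem continuous_indicatorConstLp_polyVolume (r : ℕ) {s : ℝ → Set ℝ}
    (hs : ∀ x, MeasurableSet (s x)) (hμ : ∀ x, polyVolume r (s x) ≠ ⊤)
    (hsub : ∀ x y, symmDiff (s y) (s x) ⊆ Set.uIoc x y) :
    Continuous fun x => indicatorConstLp (μ := polyVolume r) 2 (hs x) (hμ x) (1 : ℂ) := by
  refine continuous_indicatorConstLp_set (by simp) fun x => ?_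
  have hlim : Tendsto (fun y => ENNReal.ofReal ((1 + max |x| |y|) ^ r * |y - x|)) (𝓝 x) (𝓝 0) := by
    have : Continuous fun y => ENNReal.ofReal ((1 + max |x| |y|) ^ r * |y - x|) :=
      ENNReal.continuous_ofReal.comp (by fun_prop)
    simpa using this.tendsto x
  exact tendsto_of_tendsto_of_tendsto_of_le_of_le tendsto_const_nhds hlim (fun _ => zero_le)
    fun y => (measure_mono (hsub x y)).trans (polyVolume_uIoc_le r x y)

/-- The signed indicator function of the interval between `0` and `x`, as an element of `L²`. -/
noncomputable def signedIntervalLp (r : ℕ) (x : ℝ) : Lp ℂ 2 (polyVolume r) :=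
  indicatorConstLp 2 measurableSet_Ioc (polyVolume_Ioc_ne_top r 0 x) 1 -
    indicatorConstLp 2 measurableSet_Ioc (polyVolume_Ioc_ne_top r x 0) 1

/-- The signed indicator function of the interval between `0` and `x`. -/
noncomputable def signedInterval (x y : ℝ) : ℂ :=
  (Set.Ioc 0 x).indicator (fun _ => 1) y - (Set.Ioc x 0).indicator (fun _ => 1) y

theorem coeFn_signedIntervalLp (r : ℕ) (x : ℝ) :
    signedIntervalLp r x =ᵐ[polyVolume r] signedInterval x := by
  filter_upwards [Lp.coeFn_sub (indicatorConstLp 2 measurableSet_Ioc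
    (polyVolume_Ioc_ne_top r 0 x) (1 : ℂ)) (indicatorConstLp 2 measurableSet_Ioc
    (polyVolume_Ioc_ne_top r x 0) 1), indicatorConstLp_coeFn (p := 2) (c := (1 : ℂ))
    (hs := measurableSet_Ioc) (hμs := polyVolume_Ioc_ne_top r 0 x),
    indicatorConstLp_coeFn (p := 2) (c := (1 : ℂ))
    (hs := measurableSet_Ioc) (hμs := polyVolume_Ioc_ne_top r x 0)] with y h1 h2 h3
  rw [signedIntervalLp, h1, Pi.sub_apply, h2, h3, signedInterval]

theorem continuous_signedIntervalLp (r : ℕ) : Continuous (signedIntervalLp r) := by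
  refine (continuous_indicatorConstLp_polyVolume r _ _ fun x y t ht => ?_).sub
    (continuous_indicatorConstLp_polyVolume r _ _ fun x y t ht => ?_)
  all_goals
    simp only [Set.mem_symmDiff, Set.mem_Ioc, Set.mem_uIoc] at ht ⊢
    grind

theorem norm_signedIntervalLp_le (r : ℕ) (x : ℝ) :
    ‖signedIntervalLp r x‖ ≤ 2 * (1 + |x|) ^ (r + 1) := by
  rw [two_mul]
  refine (norm_sub_le _ _).trans (add_le_add ?_ ?_)
  · exact norm_indicatorConstLp_polyVolume_le r x _ _ Set.Ioc_subset_uIoc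
  · exact norm_indicatorConstLp_polyVolume_le r x _ _ Set.Ioc_subset_uIoc'

theorem measurable_signedInterval : Measurable (Function.uncurry signedInterval) := by
  have h1 : MeasurableSet {p : ℝ × ℝ | p.2 ∈ Set.Ioc 0 p.1} :=
    (measurableSet_lt measurable_const measurable_snd).inter
      (measurableSet_le measurable_snd measurable_fst)
  have h2 : MeasurableSet {p : ℝ × ℝ | p.2 ∈ Set.Ioc p.1 0} :=
    (measurableSet_lt measurable_fst measurable_snd).inter
      (measurableSet_le measurable_snd measurable_const)
  exact (measurable_const.indicator h1).sub (measurable_const.indicator h2)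

theorem norm_signedInterval_le (r : ℕ) (x y : ℝ) :
    ‖signedInterval x y‖ ≤ (1 + |x|) ^ r * ((1 + |y|) ^ r)⁻¹ := by
  have h0 : 0 ≤ (1 + |x|) ^ r * ((1 + |y|) ^ r)⁻¹ := by positivity
  have key : |y| ≤ |x| → 1 ≤ (1 + |x|) ^ r * ((1 + |y|) ^ r)⁻¹ := fun h => by
    rw [← div_eq_mul_inv, one_le_div (by positivity)]
    gcongr
  by_cases h1 : y ∈ Set.Ioc 0 x
  · have h2 : y ∉ Set.Ioc x 0 := fun h => not_lt.2 h.2 h1.1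
    have h3 := key (by rw [abs_of_pos h1.1, abs_of_pos (h1.1.trans_le h1.2)]; exact h1.2)
    simpa [signedInterval, h1, h2] using h3
  · by_cases h2 : y ∈ Set.Ioc x 0
    · have h3 := key (by
        rw [abs_of_nonpos h2.2, abs_of_nonpos (h2.1.le.trans h2.2)]; exact neg_le_neg h2.1.le)
      simpa [signedInterval, h1, h2] using h3
    · simpa [signedInterval, h1, h2] using h0

theorem SchwartzMap.integral_deriv_mul_signedInterval (φ : 𝓢(ℝ, ℂ)) (y : ℝ) :
    ∫ x, derivCLM ℂ ℂ φ x * signedInterval x y = -φ y := by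
  have hd : Integrable (derivCLM ℂ ℂ φ) := (derivCLM ℂ ℂ φ).integrable
  have hlim := φ.tendsto_cocompact
  rw [cocompact_eq_atBot_atTop] at hlim
  rcases lt_or_ge 0 y with hy | hy
  · have h : ∀ x, derivCLM ℂ ℂ φ x * signedInterval x y =
        (Set.Ici y).indicator (derivCLM ℂ ℂ φ) x := fun x => by
      simp only [signedInterval, Set.indicator, Set.mem_Ioc, Set.mem_Ici, hy, true_and,
        not_le.2 hy, and_false, if_false, sub_zero]
      split_ifs <;> simp
    simp_rw [h]
    rw [integral_indicator measurableSet_Ici, integral_Ici_eq_integral_Ioi,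
      integral_Ioi_of_hasDerivAt_of_tendsto' (f' := derivCLM ℂ ℂ φ)
      (fun t _ => φ.hasDerivAt t) hd.integrableOn (hlim.mono_left le_sup_right), zero_sub]
  · have h : ∀ x, derivCLM ℂ ℂ φ x * signedInterval x y =
        -(Set.Iio y).indicator (derivCLM ℂ ℂ φ) x := fun x => by
      simp only [signedInterval, Set.indicator, Set.mem_Ioc, Set.mem_Iio, hy, and_true,
        not_lt.2 hy, false_and, if_false, zero_sub]
      split_ifs <;> simp
    simp_rw [h]
    rw [integral_neg, integral_indicator measurableSet_Iio, ← integral_Iic_eq_integral_Iio,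
      integral_Iic_of_hasDerivAt_of_tendsto' (f' := derivCLM ℂ ℂ φ)
      (fun t _ => φ.hasDerivAt t) hd.integrableOn (hlim.mono_left le_sup_left), sub_zero]

theorem memLp_polyVolume_inv_pow (r : ℕ) :
    MemLp (fun x : ℝ => ((1 + |x|) ^ (r + 2))⁻¹) 2 (polyVolume r) := by
  have hm : Measurable (fun x : ℝ => ((1 + |x|) ^ (r + 2))⁻¹) := by fun_prop
  rw [memLp_two_iff_integrable_sq hm.aestronglyMeasurable]
  refine (integrable_polyVolume_inv_pow r).mono' (hm.pow_const 2).aestronglyMeasurable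
    (Eventually.of_forall fun x => ?_)
  have h1 : (1 : ℝ) ≤ (1 + |x|) ^ (r + 2) := one_le_pow₀ (by linarith [abs_nonneg x])
  rw [Real.norm_of_nonneg (by positivity)]
  exact pow_le_of_le_one (by positivity) (inv_le_one_of_one_le₀ h1) two_ne_zero

theorem integrable_deriv_mul_signedInterval_mul (r : ℕ) (φ : 𝓢(ℝ, ℂ))
    (v : Lp ℂ 2 (polyVolume r)) :
    Integrable (Function.uncurry fun x y =>
      φ x * signedInterval x y * starRingEnd ℂ (v y)) (volume.prod (polyVolume r)) := by
  have h1 := φ.integrable_one_add_abs_pow_mul (r + 2)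
  have h2 : Integrable (fun y => ((1 + |y|) ^ (r + 2))⁻¹ * ‖v y‖) (polyVolume r) :=
    (memLp_polyVolume_inv_pow r).integrable_mul (Lp.memLp v).norm
  refine (h1.mul_prod h2).mono' ?_ (Eventually.of_forall fun p => ?_)
  · exact ((φ.continuous.comp continuous_fst).aestronglyMeasurable.mul
      measurable_signedInterval.aestronglyMeasurable).mul
      (continuous_star.comp_aestronglyMeasurable (Lp.aestronglyMeasurable v).comp_snd)
  · simp only [Function.uncurry, norm_mul, RCLike.norm_conj]
    calc ‖φ p.1‖ * ‖signedInterval p.1 p.2‖ * ‖v p.2‖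
        ≤ ‖φ p.1‖ * ((1 + |p.1|) ^ (r + 2) * ((1 + |p.2|) ^ (r + 2))⁻¹) * ‖v p.2‖ := by
          gcongr
          exact norm_signedInterval_le _ _ _
      _ = _ := by ring

theorem SchwartzMap.toLp_eq_neg_integral_signedIntervalLp (r : ℕ) (φ : 𝓢(ℝ, ℂ)) :
    φ.toLp 2 (polyVolume r) = -∫ x, derivCLM ℂ ℂ φ x • signedIntervalLp r x := by
  have hint := integrable_schwartz_smul (derivCLM ℂ ℂ φ) (continuous_signedIntervalLp r)
    (norm_signedIntervalLp_le r)
  refine ext_inner_left ℂ fun v => ?_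
  rw [inner_neg_right, ← integral_inner hint]
  have hL : inner ℂ v (φ.toLp 2 (polyVolume r)) =
      ∫ y, φ y * starRingEnd ℂ (v y) ∂(polyVolume r) := by
    rw [L2.inner_def]
    refine integral_congr_ae ?_
    filter_upwards [φ.coeFn_toLp 2 (polyVolume r)] with y hy
    rw [hy, RCLike.inner_apply]
  have hR : ∀ x, inner ℂ v (derivCLM ℂ ℂ φ x • signedIntervalLp r x) =
      ∫ y, derivCLM ℂ ℂ φ x * signedInterval x y * starRingEnd ℂ (v y) ∂(polyVolume r) := by
    intro x
    rw [inner_smul_right, L2.inner_def, ← integral_const_mul]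
    refine integral_congr_ae ?_
    filter_upwards [coeFn_signedIntervalLp r x] with y hy
    rw [hy, RCLike.inner_apply, mul_assoc]
  simp_rw [hL, hR]
  rw [integral_integral_swap (integrable_deriv_mul_signedInterval_mul r _ v), ← integral_neg]
  refine integral_congr_ae (Eventually.of_forall fun y => ?_)
  dsimp only
  rw [integral_mul_const, integral_deriv_mul_signedInterval]
  ring

/-- Every Banach-valued tempered distribution on `ℝ` is a derivative of a continuous function of
polynomial growth. -/
theorem SchwartzMap.exists_eq_integral_iterate_deriv_smul {E : Type*} [NormedAddCommGroup E]
    [NormedSpace ℂ E] [CompleteSpace E] (T : 𝓢(ℝ, ℂ) →L[ℂ] E) :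
    ∃ (n N : ℕ) (C : ℝ) (h : ℝ → E), Continuous h ∧ (∀ x, ‖h x‖ ≤ C * (1 + |x|) ^ N) ∧
      ∀ φ : 𝓢(ℝ, ℂ), T φ = ∫ x, ((derivCLM ℂ ℂ)^[n] φ) x • h x := by
  obtain ⟨r, n, S, hS⟩ := exists_factor_toLp T
  refine ⟨n + 1, r + 1, ‖S‖ * 2, fun x => -S (signedIntervalLp r x),
    (S.continuous.comp (continuous_signedIntervalLp r)).neg, fun x => ?_, fun φ => ?_⟩
  · rw [norm_neg, mul_assoc]
    exact S.le_opNorm_of_le (norm_signedIntervalLp_le r x)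
  · rw [hS, toLp_eq_neg_integral_signedIntervalLp, map_neg, ← S.integral_comp_comm
      (integrable_schwartz_smul _ (continuous_signedIntervalLp r) (norm_signedIntervalLp_le r)),
      ← integral_neg, Function.iterate_succ_apply']
    simp

section TrigConvolution

variable {E : Type*} [NormedAddCommGroup E] [NormedSpace ℂ E]

/-- The function `x ↦ ∫ y in 0..x, p (exp (i (x - y))) • h y` for a polynomial `p`. -/
noncomputable def trigConv (h : ℝ → E) (p : Polynomial ℂ) (x : ℝ) : E :=
  ∫ y in (0 : ℝ)..x, p.eval (Complex.exp (Complex.I * (x - y : ℝ))) • h y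

theorem trigConv_add {h : ℝ → E} (hc : Continuous h) (p q : Polynomial ℂ) (x : ℝ) :
    trigConv h (p + q) x = trigConv h p x + trigConv h q x := by
  simp only [trigConv, Polynomial.eval_add, add_smul]
  refine intervalIntegral.integral_add ?_ ?_ <;>
    exact Continuous.intervalIntegrable (by fun_prop) _ _

theorem trigConv_C_mul (h : ℝ → E) (c : ℂ) (p : Polynomial ℂ) (x : ℝ) :
    trigConv h (Polynomial.C c * p) x = c • trigConv h p x := by
  simp only [trigConv, Polynomial.eval_mul, Polynomial.eval_C, mul_smul]
  exact intervalIntegral.integral_smul _ _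

theorem trigConv_X_pow (h : ℝ → E) (n : ℕ) (x : ℝ) :
    trigConv h (Polynomial.X ^ n) x = Complex.exp (n * Complex.I * x) •
      ∫ y in (0 : ℝ)..x, Complex.exp (-(n * Complex.I * y)) • h y := by
  rw [trigConv, ← intervalIntegral.integral_smul]
  refine intervalIntegral.integral_congr fun y _ => ?_
  simp only [Polynomial.eval_pow, Polynomial.eval_X]
  rw [← Complex.exp_nat_mul, smul_smul, ← Complex.exp_add]
  congr 2
  push_cast
  ring

/-- The convolution `trigConv` of `h` with `(exp (i t) - 1) ^ n`, whose kernel vanishes to order `n`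
at `t = 0` and is bounded. -/
noncomputable def trigPrimitive (h : ℝ → E) (n : ℕ) : ℝ → E :=
  trigConv h ((Polynomial.X - 1) ^ n)

theorem norm_trigPrimitive_le {h : ℝ → E} {C : ℝ} {N : ℕ}
    (hb : ∀ x, ‖h x‖ ≤ C * (1 + |x|) ^ N) (n : ℕ) (x : ℝ) :
    ‖trigPrimitive h n x‖ ≤ min 2 |x| ^ n * (C * (1 + |x|) ^ N) * |x| := by
  have hC : 0 ≤ C := by simpa using (norm_nonneg _).trans (hb 0)
  rw [trigPrimitive, trigConv]
  have hmin : 0 ≤ min 2 |x| := le_min zero_le_two (abs_nonneg x)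
  have key := intervalIntegral.norm_integral_le_of_norm_le_const (a := 0) (b := x)
    (f := fun y => ((Polynomial.X - 1 : Polynomial ℂ) ^ n).eval
      (Complex.exp (Complex.I * (x - y : ℝ))) • h y)
    (C := min 2 |x| ^ n * (C * (1 + |x|) ^ N)) fun y hy => ?_
  · rwa [sub_zero] at key
  have hy' : |y| ≤ |x| ∧ |x - y| ≤ |x| := by
    rw [Set.mem_uIoc] at hy
    rcases hy with hy | hy
    · rw [abs_of_pos hy.1, abs_of_pos (hy.1.trans_le hy.2), abs_of_nonneg (by linarith)]
      exact ⟨hy.2, by linarith⟩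
    · rw [abs_of_nonpos hy.2, abs_of_neg (hy.1.trans_le hy.2), abs_of_neg (by linarith)]
      constructor <;> linarith
  simp only [Polynomial.eval_pow, Polynomial.eval_sub, Polynomial.eval_X, Polynomial.eval_one]
  rw [norm_smul, norm_pow]
  gcongr
  · refine le_min ?_ (Real.norm_exp_I_mul_ofReal_sub_one_le.trans hy'.2)
    refine (norm_sub_le _ _).trans ?_
    rw [mul_comm, Complex.norm_exp_ofReal_mul_I, norm_one]
    norm_num
  · exact (hb y).trans (mul_le_mul_of_nonneg_left
      (pow_le_pow_left₀ (by positivity) (by linarith [hy'.1]) _) hC)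

theorem norm_trigPrimitive_le_growth {h : ℝ → E} {C : ℝ} {N : ℕ}
    (hb : ∀ x, ‖h x‖ ≤ C * (1 + |x|) ^ N) (n : ℕ) (x : ℝ) :
    ‖trigPrimitive h n x‖ ≤ 2 ^ n * C * (1 + |x|) ^ (N + 1) := by
  have hC : 0 ≤ C := by simpa using (norm_nonneg _).trans (hb 0)
  refine (norm_trigPrimitive_le hb n x).trans ?_
  calc min 2 |x| ^ n * (C * (1 + |x|) ^ N) * |x|
      ≤ 2 ^ n * (C * (1 + |x|) ^ N) * (1 + |x|) := by
        gcongr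
        · exact min_le_left _ _
        · linarith
    _ = _ := by ring

theorem norm_trigPrimitive_self_le {h : ℝ → E} {C : ℝ} {N : ℕ}
    (hb : ∀ x, ‖h x‖ ≤ C * (1 + |x|) ^ N) (x : ℝ) :
    ‖trigPrimitive h N x‖ ≤ 4 ^ N * C * |x| ^ (N + 1) := by
  have hC : 0 ≤ C := by simpa using (norm_nonneg _).trans (hb 0)
  have hmin : 0 ≤ min 2 |x| := le_min zero_le_two (abs_nonneg x)
  have h4 : min 2 |x| * (1 + |x|) ≤ 4 * |x| := by
    rcases le_total |x| 1 with hx | hx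
    · nlinarith [min_le_right 2 |x|, abs_nonneg x]
    · nlinarith [min_le_left 2 |x|]
  calc ‖trigPrimitive h N x‖ ≤ min 2 |x| ^ N * (C * (1 + |x|) ^ N) * |x| :=
        norm_trigPrimitive_le hb N x
    _ = (min 2 |x| * (1 + |x|)) ^ N * (C * |x|) := by rw [mul_pow]; ring
    _ ≤ (4 * |x|) ^ N * (C * |x|) := by gcongr
    _ = _ := by rw [mul_pow]; ring

variable [CompleteSpace E]

theorem hasDerivAt_trigConv {h : ℝ → E} (hc : Continuous h) (p : Polynomial ℂ) (x : ℝ) :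
    HasDerivAt (trigConv h p)
      (p.eval 1 • h x +
        Complex.I • trigConv h (Polynomial.X * Polynomial.derivative p) x) x := by
  induction p using Polynomial.induction_on' with
  | add p q hp hq =>
    have : trigConv h (p + q) = trigConv h p + trigConv h q := funext (trigConv_add hc p q)
    rw [this]
    convert! hp.add hq using 1
    rw [Polynomial.derivative_add, mul_add, trigConv_add hc, Polynomial.eval_add, add_smul,
      smul_add]
    abel
  | monomial n a =>
    have hfun : trigConv h (Polynomial.monomial n a) = fun x : ℝ =>
        a • (Complex.exp (n * Complex.I * x) •
          ∫ y in (0 : ℝ)..x, Complex.exp (-(n * Complex.I * y)) • h y) := by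
      ext x
      rw [← Polynomial.C_mul_X_pow_eq_monomial, trigConv_C_mul, trigConv_X_pow]
    have hder : Polynomial.X * Polynomial.derivative (Polynomial.monomial n a) =
        Polynomial.C (a * n) * Polynomial.X ^ n := by
      rw [Polynomial.derivative_monomial, ← Polynomial.C_mul_X_pow_eq_monomial]
      rcases n with _ | n
      · simp
      · rw [Nat.add_sub_cancel]; ring
    rw [hfun, hder, trigConv_C_mul, trigConv_X_pow]
    have hc' : Continuous fun y : ℝ => Complex.exp (-(n * Complex.I * y)) • h y := by fun_prop
    have h1 := hc'.integral_hasStrictDerivAt 0 x |>.hasDerivAt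
    have h2 : HasDerivAt (fun x : ℝ => Complex.exp (n * Complex.I * x))
        (Complex.exp (n * Complex.I * x) * (n * Complex.I)) x := by
      have := ((hasDerivAt_id (x : ℂ)).const_mul (n * Complex.I)).cexp.comp_ofReal
      simpa using this
    convert! (h2.smul h1).const_smul a using 1
    rw [smul_smul (Complex.exp _), ← Complex.exp_add, add_neg_cancel, Complex.exp_zero]
    simp only [Polynomial.eval_monomial, one_pow, mul_one, one_smul, smul_add, smul_smul]
    congr 2
    ring

theorem hasDerivAt_trigPrimitive_zero {h : ℝ → E} (hc : Continuous h) (x : ℝ) :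
    HasDerivAt (trigPrimitive h 0) (h x) x := by
  have := hasDerivAt_trigConv hc ((Polynomial.X - 1) ^ 0) x
  simpa [trigPrimitive, trigConv] using this

theorem hasDerivAt_trigPrimitive_succ {h : ℝ → E} (hc : Continuous h) (n : ℕ) (x : ℝ) :
    HasDerivAt (trigPrimitive h (n + 1))
      ((Complex.I * (n + 1)) • (trigPrimitive h (n + 1) x + trigPrimitive h n x)) x := by
  convert! hasDerivAt_trigConv hc ((Polynomial.X - 1) ^ (n + 1)) x using 1
  have hd : Polynomial.X * Polynomial.derivative ((Polynomial.X - 1 : Polynomial ℂ) ^ (n + 1)) =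
      Polynomial.C (n + 1 : ℂ) * ((Polynomial.X - 1) ^ (n + 1) + (Polynomial.X - 1) ^ n) := by
    rw [Polynomial.derivative_pow_succ]
    simp only [Polynomial.derivative_sub, Polynomial.derivative_X, Polynomial.derivative_one]
    ring
  rw [hd, trigConv_C_mul, trigConv_add hc]
  simp [trigPrimitive, smul_smul]

theorem continuous_trigPrimitive {h : ℝ → E} (hc : Continuous h) (n : ℕ) :
    Continuous (trigPrimitive h n) :=
  continuous_iff_continuousAt.2 fun x =>
    (hasDerivAt_trigConv hc ((Polynomial.X - 1) ^ n) x).continuousAt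

end TrigConvolution

section Pairing

variable {E : Type*} [NormedAddCommGroup E] [NormedSpace ℂ E]

/-- The linear map `φ ↦ ∫ φ • h` on Schwartz functions, for `h` continuous of polynomial growth. -/
noncomputable def schwartzPairing (h : ℝ → E) (hc : Continuous h) {C : ℝ} {N : ℕ}
    (hb : ∀ x, ‖h x‖ ≤ C * (1 + |x|) ^ N) : 𝓢(ℝ, ℂ) →ₗ[ℂ] E where
  toFun φ := ∫ x, φ x • h x
  map_add' φ ψ := by
    simp only [add_apply, add_smul]
    exact integral_add (integrable_schwartz_smul φ hc hb) (integrable_schwartz_smul ψ hc hb)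
  map_smul' c φ := by
    simp only [smul_apply, smul_assoc, RingHom.id_apply]
    exact integral_smul _ _

theorem integral_smul_hasDerivAt_eq_neg {F F' : ℝ → E} (hF : ∀ x, HasDerivAt F (F' x) x)
    (hc : Continuous F') {C C' : ℝ} {N N' : ℕ} (hb : ∀ x, ‖F x‖ ≤ C * (1 + |x|) ^ N)
    (hb' : ∀ x, ‖F' x‖ ≤ C' * (1 + |x|) ^ N') (φ : 𝓢(ℝ, ℂ)) :
    ∫ x, φ x • F' x = -∫ x, derivCLM ℂ ℂ φ x • F x := by
  have hcF : Continuous F := continuous_iff_continuousAt.2 fun x => (hF x).continuousAt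
  exact integral_bilinear_hasDerivAt_right_eq_neg_left_of_integrable
    (L := ContinuousLinearMap.lsmul ℝ ℂ) (u := φ) (u' := derivCLM ℂ ℂ φ)
    (fun x _ => φ.hasDerivAt x) (fun x _ => hF x) (integrable_schwartz_smul φ hc hb')
    (integrable_schwartz_smul _ hcF hb) (integrable_schwartz_smul φ hcF hb)

variable [CompleteSpace E]

theorem exists_polynomial_integral_eq_trigPrimitive {h : ℝ → E} (hc : Continuous h) {C : ℝ} {N : ℕ}
    (hb : ∀ x, ‖h x‖ ≤ C * (1 + |x|) ^ N) (n : ℕ) :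
    ∃ p : Polynomial ℂ, ∀ φ : 𝓢(ℝ, ℂ), ∫ x, φ x • h x =
      schwartzPairing (trigPrimitive h n) (continuous_trigPrimitive hc n)
        (norm_trigPrimitive_le_growth hb n)
        (Polynomial.aeval ((derivCLM ℂ ℂ).toLinearMap : Module.End ℂ 𝓢(ℝ, ℂ)) p φ) := by
  induction n with
  | zero =>
    refine ⟨-Polynomial.X, fun φ => ?_⟩
    rw [map_neg, Polynomial.aeval_X, LinearMap.neg_apply, map_neg]
    exact integral_smul_hasDerivAt_eq_neg (hasDerivAt_trigPrimitive_zero hc) hc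
      (norm_trigPrimitive_le_growth hb 0) hb φ
  | succ n ih =>
    obtain ⟨p, hp⟩ := ih
    set c : ℂ := Complex.I * (n + 1) with hcdef
    have hc0 : c ≠ 0 := mul_ne_zero Complex.I_ne_zero (Nat.cast_add_one_ne_zero n)
    set A := schwartzPairing (trigPrimitive h n) (continuous_trigPrimitive hc n)
        (norm_trigPrimitive_le_growth hb n)
    set B := schwartzPairing (trigPrimitive h (n + 1)) (continuous_trigPrimitive hc (n + 1))
        (norm_trigPrimitive_le_growth hb (n + 1))
    have hAB : ∀ φ, c • (B φ + A φ) = -B (derivCLM ℂ ℂ φ) := fun φ => by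
      have h1 := integral_smul_hasDerivAt_eq_neg (hasDerivAt_trigPrimitive_succ hc n)
        (((continuous_trigPrimitive hc (n + 1)).add (continuous_trigPrimitive hc n)).const_smul c)
        (norm_trigPrimitive_le_growth hb (n + 1)) (fun x => ?_) φ
        (C' := ‖c‖ * (2 ^ (n + 1) * C + 2 ^ n * C)) (N' := N + 1)
      · refine Eq.trans ?_ h1
        simp_rw [smul_comm (φ _), smul_add]
        rw [integral_add, integral_smul, integral_smul]
        · rfl
        · exact (integrable_schwartz_smul φ (continuous_trigPrimitive hc (n + 1))
            (norm_trigPrimitive_le_growth hb (n + 1))).smul c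
        · exact (integrable_schwartz_smul φ (continuous_trigPrimitive hc n)
            (norm_trigPrimitive_le_growth hb n)).smul c
      · rw [norm_smul, mul_assoc, add_mul]
        gcongr
        exact (norm_add_le _ _).trans (add_le_add (norm_trigPrimitive_le_growth hb (n + 1) x)
          (norm_trigPrimitive_le_growth hb n x))
    have hA : ∀ φ, A φ = B (-(c⁻¹ • derivCLM ℂ ℂ φ) - φ) := fun φ => by
      have := congrArg (c⁻¹ • ·) (hAB φ)
      simp only [inv_smul_smul₀ hc0] at this
      rw [map_sub, map_neg, map_smul, ← smul_neg, ← this]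
      abel
    refine ⟨(-(Polynomial.C c⁻¹ * Polynomial.X) - 1) * p, fun φ => ?_⟩
    rw [hp, hA, map_mul]
    simp [Module.algebraMap_end_apply]

end Pairing

/-- Structure theorem for `E`-valued tempered distributions of exponential type `a ≥ 0`:
a distribution `T ∈ SE'_a(ℝ,E)` (modelled via its image `e^{-a·}T ∈ S'(ℝ,E)`, i.e. as a
continuous linear map on the Schwartz space) is a finite sum of distributional derivatives
`T = P(d/dt) g` of a continuous function `g : ℝ → E` satisfying
`e^{-ax} ‖g(x)‖ ≤ C |x|^k`. -/
theorem stmt15 {E : Type*} [NormedAddCommGroup E] [NormedSpace ℂ E] [CompleteSpace E]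
    (a : ℝ) (ha : 0 ≤ a) (T : SchwartzMap ℝ ℂ →L[ℂ] E) :
    ∃ (m : ℕ) (c : ℕ → ℂ) (g : ℝ → E) (C k : ℝ), 0 < C ∧ 0 < k ∧
      Continuous g ∧
      (∀ x : ℝ, Real.exp (-a * x) * ‖g x‖ ≤ C * |x| ^ k) ∧
      ∀ ψ : SchwartzMap ℝ ℂ,
        T ψ = ∑ j ∈ Finset.range (m + 1),
          c j • ∫ x : ℝ, iteratedDeriv j (fun t : ℝ => ψ t) x •
            (Real.exp (-a * x) • g x) := by
  obtain ⟨n, N, C, h, hc, hb, hT⟩ := exists_eq_integral_iterate_deriv_smul T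
  obtain ⟨p, hp⟩ := exists_polynomial_integral_eq_trigPrimitive hc hb N
  have hC : 0 ≤ C := by simpa using (norm_nonneg _).trans (hb 0)
  have hcancel : ∀ x, Real.exp (-a * x) • Real.exp (a * x) • trigPrimitive h N x =
      trigPrimitive h N x := fun x => by
    rw [smul_smul, ← Real.exp_add]
    simp
  refine ⟨(p * Polynomial.X ^ n).natDegree, (p * Polynomial.X ^ n).coeff,
    fun x => Real.exp (a * x) • trigPrimitive h N x, 4 ^ N * C + 1, (N + 1 : ℕ),
    by positivity, by positivity, ?_, fun x => ?_, fun ψ => ?_⟩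
  · have := continuous_trigPrimitive hc N
    fun_prop
  · rw [← abs_of_pos (Real.exp_pos (-a * x)), ← Real.norm_eq_abs, ← norm_smul, hcancel,
      Real.rpow_natCast]
    refine (norm_trigPrimitive_self_le hb x).trans ?_
    gcongr
    linarith
  · simp only [hcancel]
    set D : Module.End ℂ 𝓢(ℝ, ℂ) := (derivCLM ℂ ℂ).toLinearMap with hD
    have hDn : ∀ j φ, (D ^ j) φ = (derivCLM ℂ ℂ)^[j] φ := fun j φ => by
      rw [Module.End.pow_apply]
      rfl
    have hmul : Polynomial.aeval D (p * Polynomial.X ^ n) ψ =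
        Polynomial.aeval D p ((derivCLM ℂ ℂ)^[n] ψ) := by
      rw [map_mul, map_pow, Polynomial.aeval_X, Module.End.mul_apply, hDn]
    rw [hT, hp, ← hmul, Polynomial.aeval_eq_sum_range]
    simp only [LinearMap.sum_apply, LinearMap.smul_apply, map_sum, map_smul, hDn]
    refine Finset.sum_congr rfl fun j _ => ?_
    congr 1
    exact integral_congr_ae (Eventually.of_forall fun x => by
      simp only [coe_iterate_derivCLM])
end

section
/- Let A be closed and densely defined on a Banach space E such that ρ(A) ⊇ { λ : Re λ > a } and ‖R(λ:A)‖ ≤ C(1+|λ|)^k for Re λ > a. Then A generates a global exponentially bounded K-convoluted semigroup (S_K(t))_{t≥0} where K = L^{−1}(1/P_L(−iλ)) for a suitable polynomial P_L dominating (1+|λ|)^{k+2}. -/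
open Set MeasureTheory Polynomial

/-- The point `c + 2πiξ`, parametrising the vertical line of abscissa `c`. -/
noncomputable def vline (c ξ : ℝ) : ℂ := ⟨c, 2 * Real.pi * ξ⟩

theorem vline_eq (c ξ : ℝ) : vline c ξ = c + (2 * Real.pi * ξ : ℝ) * Complex.I :=
  Complex.mk_eq_add_mul_I _ _

theorem vline_re (c ξ : ℝ) : (vline c ξ).re = c := rfl

theorem continuous_vline (c : ℝ) : Continuous (vline c) := by
  simp only [funext (vline_eq c)]
  fun_prop

theorem one_add_sq_le_norm_vline (c ξ : ℝ) : 1 + ξ ^ 2 ≤ (1 + ‖vline c ξ‖) ^ 2 := by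
  have h1 : |ξ| ≤ ‖vline c ξ‖ := by
    refine le_trans ?_ (Complex.abs_im_le_norm (vline c ξ))
    change |ξ| ≤ |2 * Real.pi * ξ|
    rw [abs_mul, abs_of_pos Real.two_pi_pos]
    have := Real.pi_gt_three
    nlinarith [abs_nonneg ξ]
  nlinarith [sq_abs ξ, abs_nonneg ξ]

theorem le_norm_vline (c ξ : ℝ) : c ≤ ‖vline c ξ‖ :=
  Complex.re_le_norm (vline c ξ)

theorem vline_ne_zero {c : ℝ} (hc : 0 < c) (ξ : ℝ) : vline c ξ ≠ 0 := by
  intro h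
  have := congrArg Complex.re h
  rw [vline_re, Complex.zero_re] at this
  exact hc.ne' this

theorem inv_sq_le_inv_one_add_sq (c ξ : ℝ) :
    ((1 + ‖vline c ξ‖) ^ 2)⁻¹ ≤ (1 + ξ ^ 2)⁻¹ :=
  inv_anti₀ (by positivity) (one_add_sq_le_norm_vline c ξ)

theorem hasDerivAt_vline_left (c ξ : ℝ) : HasDerivAt (fun c : ℝ => vline c ξ) 1 c := by
  simp only [vline_eq]
  exact (Complex.ofRealCLM.hasDerivAt (x := c)).add_const _

theorem hasDerivAt_vline_right (c ξ : ℝ) :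
    HasDerivAt (vline c) (2 * Real.pi * Complex.I) ξ := by
  have h := ((((hasDerivAt_id ξ).const_mul (2 * Real.pi)).ofReal_comp).mul_const
    Complex.I).const_add (c : ℂ)
  simp only [funext (vline_eq c)]
  simpa using h

theorem integrable_vline_of_norm_le {F : Type*} [NormedAddCommGroup F]
    {G : ℂ → F} {a B c : ℝ}
    (hcont : ContinuousOn G {z | a < z.re})
    (hbound : ∀ z : ℂ, a < z.re → ‖G z‖ ≤ B * ((1 + ‖z‖) ^ 2)⁻¹) (hB : 0 ≤ B) (hc : a < c) :
    Continuous (fun ξ => G (vline c ξ)) ∧ Integrable fun ξ => G (vline c ξ) := by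
  have h : Continuous fun ξ => G (vline c ξ) :=
    hcont.comp_continuous (continuous_vline c) fun ξ => hc
  refine ⟨h, (integrable_inv_one_add_sq.const_mul B).mono' h.aestronglyMeasurable ?_⟩
  refine .of_forall fun ξ => (hbound _ hc).trans ?_
  exact mul_le_mul_of_nonneg_left (inv_sq_le_inv_one_add_sq c ξ) hB

section VerticalIntegral

variable {F : Type*} [NormedAddCommGroup F] [NormedSpace ℂ F]

/-- Cauchy's theorem for a half plane: the integral over a vertical line of a holomorphic
function vanishes if the function decays cubically and its derivative quadratically. -/
theorem integral_vline_eq_zero [CompleteSpace F] {G G' : ℂ → F} {a B c : ℝ}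
    (hG : ∀ z : ℂ, a < z.re → HasDerivAt G (G' z) z)
    (hG' : ContinuousOn G' {z | a < z.re}) (hB : 0 ≤ B)
    (hGB : ∀ z : ℂ, a < z.re → ‖G z‖ ≤ B * ((1 + ‖z‖) ^ 3)⁻¹)
    (hGB' : ∀ z : ℂ, a < z.re → ‖G' z‖ ≤ B * ((1 + ‖z‖) ^ 2)⁻¹) (hc : a < c) :
    ∫ ξ, G (vline c ξ) = 0 := by
  have hcont : ContinuousOn G {z | a < z.re} :=
    fun z hz => (hG z hz).continuousAt.continuousWithinAt
  have hGB2 : ∀ z : ℂ, a < z.re → ‖G z‖ ≤ B * ((1 + ‖z‖) ^ 2)⁻¹ := fun z hz => by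
    refine (hGB z hz).trans (mul_le_mul_of_nonneg_left (inv_anti₀ (by positivity) ?_) hB)
    exact pow_le_pow_right₀ (by linarith [norm_nonneg z]) (by norm_num)
  have hint := fun c' (h : a < c') => integrable_vline_of_norm_le hcont hGB2 hB h
  have hint' := fun c' (h : a < c') => integrable_vline_of_norm_le hG' hGB' hB h
  have hzero : ∀ c', a < c' → ∫ ξ, G' (vline c' ξ) = 0 := by
    intro c' h
    have h0 := integral_eq_zero_of_hasDerivAt_of_integrable
      (f := fun ξ => G (vline c' ξ)) (f' := fun ξ => (2 * Real.pi * Complex.I) • G' (vline c' ξ))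
      (fun ξ => (hG (vline c' ξ) h).scomp ξ (hasDerivAt_vline_right c' ξ))
      ((hint' c' h).2.smul _) (hint c' h).2
    rw [integral_smul, smul_eq_zero] at h0
    exact h0.resolve_left Complex.two_pi_I_ne_zero
  have hderiv : ∀ c', a < c' → HasDerivAt (fun c => ∫ ξ, G (vline c ξ)) 0 c' := by
    intro c' h
    have h1 := (hasDerivAt_integral_of_dominated_loc_of_deriv_le (μ := volume)
      (F := fun c ξ => G (vline c ξ)) (F' := fun c ξ => G' (vline c ξ)) (x₀ := c')
      (bound := fun ξ => B * (1 + ξ ^ 2)⁻¹) (Ioi_mem_nhds h)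
      (Filter.eventually_of_mem (Ioi_mem_nhds h) fun x hx => (hint x hx).1.aestronglyMeasurable)
      (hint c' h).2 (hint' c' h).1.aestronglyMeasurable
      (.of_forall fun ξ x hx => (hGB' (vline x ξ) hx).trans
        (mul_le_mul_of_nonneg_left (inv_sq_le_inv_one_add_sq x ξ) hB))
      (integrable_inv_one_add_sq.const_mul B)
      (.of_forall fun ξ x hx => by
        simpa [Function.comp_def] using (hG (vline x ξ) hx).scomp x (hasDerivAt_vline_left x ξ))).2
    rwa [hzero c' h] at h1
  have hconst : ∀ c', a < c' → ∫ ξ, G (vline c' ξ) = ∫ ξ, G (vline c ξ) := fun c' h =>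
    isOpen_Ioi.is_const_of_deriv_eq_zero (𝕜 := ℝ) (f := fun c => ∫ ξ, G (vline c ξ))
      isPreconnected_Ioi
      (fun x hx => (hderiv x hx).differentiableAt.differentiableWithinAt)
      (fun x hx => (hderiv x hx).deriv) h hc
  have hle : ∀ c', max a 0 < c' →
      ‖∫ ξ, G (vline c ξ)‖ ≤ (∫ ξ : ℝ, B * (1 + ξ ^ 2)⁻¹) * c'⁻¹ := by
    intro c' h
    obtain ⟨h, h0⟩ := max_lt_iff.1 h
    rw [← hconst c' h, ← integral_mul_const]
    refine norm_integral_le_of_norm_le ((integrable_inv_one_add_sq.const_mul B).mul_const _)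
      (.of_forall fun ξ => (hGB _ h).trans ?_)
    rw [mul_assoc, pow_succ, mul_inv]
    refine mul_le_mul_of_nonneg_left (mul_le_mul (inv_sq_le_inv_one_add_sq c' ξ) ?_
      (by positivity) (by positivity)) hB
    exact inv_anti₀ h0 (by linarith [le_norm_vline c' ξ])
  have hlim : Filter.Tendsto (fun c' : ℝ => (∫ ξ : ℝ, B * (1 + ξ ^ 2)⁻¹) * c'⁻¹)
      Filter.atTop (nhds 0) := by
    simpa using (tendsto_inv_atTop_zero (𝕜 := ℝ)).const_mul (∫ ξ : ℝ, B * (1 + ξ ^ 2)⁻¹)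
  refine norm_le_zero_iff.1 (ge_of_tendsto hlim ?_)
  filter_upwards [Filter.eventually_gt_atTop (max a 0)] with c' h using hle c' h

/-- The inverse Laplace integral of `g` along the vertical line of abscissa `c`. -/
noncomputable def vlineIntegral (c : ℝ) (g : ℝ → F) (t : ℝ) : F :=
  ∫ ξ, Complex.exp (vline c ξ * t) • g ξ

theorem norm_exp_vline (c ξ t : ℝ) : ‖Complex.exp (vline c ξ * t)‖ = Real.exp (c * t) := by
  rw [Complex.norm_exp]
  simp [vline_re]

theorem continuous_exp_vline (c t : ℝ) : Continuous fun ξ => Complex.exp (vline c ξ * t) := by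
  have := continuous_vline c
  fun_prop

theorem integrable_exp_vline_smul (c t : ℝ) {g : ℝ → F} (hg : Integrable g) :
    Integrable fun ξ => Complex.exp (vline c ξ * t) • g ξ :=
  hg.bdd_smul (Real.exp (c * t)) (continuous_exp_vline c t).aestronglyMeasurable
    (.of_forall fun ξ => (norm_exp_vline c ξ t).le)

theorem norm_vlineIntegral_le (c t : ℝ) (g : ℝ → F) :
    ‖vlineIntegral c g t‖ ≤ (∫ ξ, ‖g ξ‖) * Real.exp (c * t) := by
  refine (norm_integral_le_integral_norm _).trans_eq ?_
  simp_rw [norm_smul, norm_exp_vline, integral_const_mul]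
  rw [mul_comm]

theorem continuous_vlineIntegral (c : ℝ) {g : ℝ → F} (hg : Integrable g) :
    Continuous (vlineIntegral c g) := by
  have h : vlineIntegral c g = fun t : ℝ => Complex.exp (c * t) •
      ∫ ξ, Complex.exp (vline 0 ξ * t) • g ξ := by
    funext t
    rw [vlineIntegral, ← integral_smul]
    congr 1 with ξ
    rw [smul_smul, ← Complex.exp_add, vline_eq, vline_eq]
    congr 2
    push_cast
    ring
  rw [h]
  refine Continuous.smul (by fun_prop) (continuous_of_dominated (bound := fun ξ => ‖g ξ‖)
    (fun t => (integrable_exp_vline_smul 0 t hg).aestronglyMeasurable) (fun t => ?_) hg.norm ?_)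
  · refine .of_forall fun ξ => ?_
    rw [norm_smul, norm_exp_vline]
    simp
  · exact .of_forall fun ξ => by fun_prop

/-- The kernel `∫₀ᵗ e^{λs} ds` at `λ = c + 2πiξ`. -/
noncomputable def vlineKernel (c t ξ : ℝ) : ℂ :=
  (Complex.exp (vline c ξ * t) - 1) / vline c ξ

theorem continuous_vlineKernel {c : ℝ} (hc : 0 < c) (t : ℝ) : Continuous (vlineKernel c t) :=
  ((continuous_exp_vline c t).sub continuous_const).div (continuous_vline c) (vline_ne_zero hc)

theorem norm_vlineKernel_le {c : ℝ} (hc : 0 < c) (t ξ : ℝ) :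
    ‖vlineKernel c t ξ‖ ≤ (Real.exp (c * t) + 1) / c := by
  rw [vlineKernel, norm_div]
  refine div_le_div₀ (by positivity) ?_ hc (le_norm_vline c ξ)
  refine (norm_sub_le _ _).trans ?_
  rw [norm_exp_vline, norm_one]

theorem integrable_vlineKernel_smul {c : ℝ} (hc : 0 < c) (t : ℝ) {g : ℝ → F}
    (hg : Integrable g) : Integrable fun ξ => vlineKernel c t ξ • g ξ :=
  hg.bdd_smul _ (continuous_vlineKernel hc t).aestronglyMeasurable
    (.of_forall (norm_vlineKernel_le hc t))

theorem intervalIntegral_vlineIntegral [CompleteSpace F] {c : ℝ} (hc : 0 < c) {t : ℝ} (ht : 0 ≤ t)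
    {g : ℝ → F} (hgc : Continuous g) (hg : Integrable g) :
    ∫ s in (0 : ℝ)..t, vlineIntegral c g s = ∫ ξ, vlineKernel c t ξ • g ξ := by
  have hv := continuous_vline c
  simp only [vlineIntegral]
  rw [intervalIntegral.integral_of_le ht, integral_integral_swap]
  · congr 1 with ξ
    rw [integral_smul_const, ← intervalIntegral.integral_of_le ht,
      integral_exp_mul_complex (vline_ne_zero hc ξ)]
    simp [vlineKernel]
  · refine Integrable.mono' (g := fun p : ℝ × ℝ => Real.exp (c * p.1) * ‖g p.2‖)
      (Integrable.mul_prod (f := fun s : ℝ => Real.exp (c * s)) ?_ hg.norm)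
      (Continuous.aestronglyMeasurable (by fun_prop)) (.of_forall fun p => ?_)
    · exact (Continuous.integrableOn_Icc (by fun_prop)).mono_set Ioc_subset_Icc_self
    · rw [Function.uncurry, norm_smul, norm_exp_vline]

end VerticalIntegral

/-- The function `tⁿ e^{-bt} / (n! Mⁿ⁺¹)` on the positive half line, extended by zero, whose
Laplace transform is `(M (z + b))⁻ⁿ⁻¹`. -/
noncomputable def convKernel (M b : ℝ) (n : ℕ) (t : ℝ) : ℂ :=
  (max t 0 ^ n * Real.exp (-b * t) / (n.factorial * M ^ (n + 1)) : ℝ)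

theorem continuous_convKernel (M b : ℝ) (n : ℕ) : Continuous (convKernel M b n) := by
  unfold convKernel
  fun_prop

theorem convKernel_of_nonpos (M b : ℝ) {n : ℕ} (hn : n ≠ 0) {t : ℝ} (ht : t ≤ 0) :
    convKernel M b n t = 0 := by
  simp [convKernel, max_eq_right ht, hn]

theorem integrableOn_pow_mul_exp_neg (n : ℕ) {z : ℂ} (hz : 0 < z.re) :
    IntegrableOn (fun t : ℝ => (t : ℂ) ^ n * Complex.exp (-z * t)) (Ioi 0) := by
  have h := integrableOn_rpow_mul_exp_neg_mul_rpow (p := 1) (s := n) (b := z.re)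
    (by linarith [n.cast_nonneg (α := ℝ)]) one_pos hz
  refine Integrable.mono' h (Continuous.aestronglyMeasurable (by fun_prop)) ?_
  filter_upwards [self_mem_ae_restrict measurableSet_Ioi] with t ht
  rw [norm_mul, norm_pow, Complex.norm_real, Real.norm_of_nonneg (le_of_lt (mem_Ioi.1 ht)),
    Complex.norm_exp, Real.rpow_one, Real.rpow_natCast]
  simp

theorem integral_pow_mul_exp_neg (n : ℕ) {z : ℂ} (hz : 0 < z.re) :
    ∫ t in Ioi (0 : ℝ), (t : ℂ) ^ n * Complex.exp (-z * t) = n.factorial / z ^ (n + 1) := by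
  have hz0 : z ≠ 0 := by
    rintro rfl
    simp at hz
  induction n with
  | zero =>
    simp only [pow_zero, one_mul]
    rw [integral_exp_mul_complex_Ioi (by simpa using hz)]
    simp
  | succ n ih =>
    have hderiv : ∀ t ∈ Ici (0 : ℝ), HasDerivAt
        (fun t : ℝ => (t : ℂ) ^ (n + 1) * Complex.exp (-z * t))
        ((n + 1) * ((t : ℂ) ^ n * Complex.exp (-z * t)) -
          z * ((t : ℂ) ^ (n + 1) * Complex.exp (-z * t))) t := by
      intro t _
      have h1 := (hasDerivAt_pow (n + 1) (t : ℂ)).mul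
        (((hasDerivAt_id (t : ℂ)).const_mul (-z)).cexp)
      refine (h1.comp_ofReal).congr_deriv ?_
      simp only [id, Nat.add_sub_cancel]
      push_cast
      ring
    have hlim : Filter.Tendsto (fun t : ℝ => (t : ℂ) ^ (n + 1) * Complex.exp (-z * t))
        Filter.atTop (nhds 0) := by
      rw [tendsto_zero_iff_norm_tendsto_zero]
      refine (tendsto_rpow_mul_exp_neg_mul_atTop_nhds_zero (n + 1 : ℕ) z.re hz).congr' ?_
      filter_upwards [Filter.eventually_gt_atTop 0] with t ht
      rw [norm_mul, norm_pow, Complex.norm_real, Real.norm_of_nonneg ht.le, Complex.norm_exp,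
        Real.rpow_natCast]
      simp
    have hn := (integrableOn_pow_mul_exp_neg n hz).const_mul ((n : ℂ) + 1)
    have hn' := (integrableOn_pow_mul_exp_neg (n + 1) hz).const_mul z
    have h := integral_Ioi_of_hasDerivAt_of_tendsto' hderiv (hn.sub hn') hlim
    rw [integral_sub hn hn', integral_const_mul, integral_const_mul, ih] at h
    rw [Nat.factorial_succ, eq_div_iff (pow_ne_zero _ hz0), pow_succ]
    have h0 : (0 : ℂ) - ((0 : ℝ) : ℂ) ^ (n + 1) * Complex.exp (-z * (0 : ℝ)) = 0 := by simp
    rw [h0, sub_eq_zero, mul_div_assoc', div_eq_iff (pow_ne_zero _ hz0)] at h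
    push_cast
    rw [h]
    ring

theorem exp_mul_convKernel (M b : ℝ) (n : ℕ) (z : ℂ) {t : ℝ} (ht : t ∈ Ioi (0 : ℝ)) :
    Complex.exp (-z * t) * convKernel M b n t =
      ((n.factorial : ℂ) * M ^ (n + 1))⁻¹ * ((t : ℂ) ^ n * Complex.exp (-(z + b) * t)) := by
  rw [convKernel, max_eq_left (le_of_lt (mem_Ioi.1 ht)),
    show -(z + b) * (t : ℂ) = -z * t + -b * t by ring, Complex.exp_add]
  push_cast
  ring

theorem laplace_convKernel (M b : ℝ) (n : ℕ) {z : ℂ} (hz : 0 < (z + b).re) :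
    ∫ t in Ioi (0 : ℝ), Complex.exp (-z * t) * convKernel M b n t =
      ((M * (z + b)) ^ (n + 1))⁻¹ := by
  rw [setIntegral_congr_fun measurableSet_Ioi fun t ht => exp_mul_convKernel M b n z ht,
    integral_const_mul, integral_pow_mul_exp_neg n hz]
  have : (n.factorial : ℂ) ≠ 0 := by exact_mod_cast n.factorial_ne_zero
  rw [mul_inv, mul_pow, mul_inv]
  field_simp

theorem integrable_exp_mul_convKernel (M : ℝ) {b c : ℝ} {n : ℕ} (hn : n ≠ 0) (h : 0 < c + b) :
    Integrable fun t : ℝ => Complex.exp (-c * t) * convKernel M b n t := by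
  rw [← integrableOn_iff_integrable_of_support_subset (s := Ioi (0 : ℝ))]
  · exact IntegrableOn.congr_fun
      ((integrableOn_pow_mul_exp_neg n (z := c + b) (by simpa using h)).const_mul _)
      (fun t ht => (exp_mul_convKernel M b n c ht).symm) measurableSet_Ioi
  · intro t ht
    by_contra h0
    exact ht (by simp [convKernel_of_nonpos M b hn (not_lt.1 h0)])

theorem vlineIntegral_inv_pow {M b c : ℝ} {n : ℕ} (hn : n ≠ 0) (h : 0 < c + b)
    (hint : Integrable fun ξ => ((M * (vline c ξ + b)) ^ (n + 1))⁻¹) (t : ℝ) :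
    vlineIntegral c (fun ξ => ((M * (vline c ξ + b)) ^ (n + 1))⁻¹) t = convKernel M b n t := by
  set φ : ℝ → ℂ := fun t => Complex.exp (-c * t) * convKernel M b n t with hφ
  have hφc : Continuous φ := by
    have := continuous_convKernel M b n
    fun_prop
  have hF : FourierTransform.fourier φ = fun ξ => ((M * (vline c ξ + b)) ^ (n + 1))⁻¹ := by
    funext ξ
    rw [Real.fourier_real_eq_integral_exp_smul, ← laplace_convKernel M b n (z := vline c ξ)
      (by simpa [vline_re] using h), ← setIntegral_eq_integral_of_forall_compl_eq_zero
        (s := Ioi (0 : ℝ))]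
    · congr 1 with t
      rw [hφ, smul_eq_mul, ← mul_assoc, ← Complex.exp_add, vline_eq]
      congr 2
      push_cast
      ring
    · intro t ht
      simp [hφ, convKernel_of_nonpos M b hn (not_lt.1 ht)]
  have hinv := congrFun (hφc.fourierInv_fourier_eq (integrable_exp_mul_convKernel M hn h)
    (by rw [hF]; exact hint)) t
  rw [hF, Real.fourierInv_eq'] at hinv
  have h3 : vlineIntegral c (fun ξ => ((M * (vline c ξ + b)) ^ (n + 1))⁻¹) t =
      Complex.exp (c * t) * φ t := by
    rw [← hinv, ← integral_const_mul, vlineIntegral]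
    refine integral_congr_ae (.of_forall fun ξ => ?_)
    dsimp only
    rw [smul_eq_mul, smul_eq_mul, ← mul_assoc, ← Complex.exp_add, vline_eq]
    congr 2
    simp only [RCLike.inner_apply, conj_trivial]
    push_cast
    ring
  rw [h3, hφ, ← mul_assoc, ← Complex.exp_add]
  simp

section Resolvent

variable {E : Type*} [NormedAddCommGroup E] [NormedSpace ℂ E] {f : E →ₗ[ℂ] E} {D : Submodule ℂ E}

theorem IsResolvent.map_eq {z : ℂ} {R : E →L[ℂ] E} (h : IsResolvent f D z R) (x : E) :
    f (R x) = z • R x - x := by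
  rw [eq_sub_iff_add_eq, ← eq_sub_iff_add_eq', (h.1 x).2]

theorem IsResolvent.map_comm_s16 {z : ℂ} {R : E →L[ℂ] E} (h : IsResolvent f D z R) {x : E}
    (hx : x ∈ D) : f (R x) = R (f x) := by
  have := h.2 x hx
  rw [map_sub, map_smul, sub_eq_iff_eq_add] at this
  rw [h.map_eq, this, add_sub_cancel_left]

/-- The resolvent identity. -/
theorem IsResolvent.sub_eq {z w : ℂ} {R T : E →L[ℂ] E} (hR : IsResolvent f D z R)
    (hT : IsResolvent f D w T) : R - T = (w - z) • (R * T) := by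
  ext x
  have h := hR.2 (T x) (hT.1 x).1
  rw [hT.map_eq, show z • T x - (w • T x - x) = x - (w - z) • T x by module, map_sub,
    map_smul] at h
  change R x - T x = (w - z) • R (T x)
  rw [sub_eq_iff_eq_add, add_comm, ← sub_eq_iff_eq_add, h]

/-- An operator with nonempty resolvent set commutes with Bochner integrals. -/
theorem IsResolvent.integral_mem [CompleteSpace E] {z : ℂ} {R : E →L[ℂ] E}
    (h : IsResolvent f D z R) {α : Type*} [MeasurableSpace α] {μ : Measure α} {u v : α → E}
    (hu : Integrable u μ) (hv : Integrable v μ) (huD : ∀ s, u s ∈ D) (huv : ∀ s, f (u s) = v s) :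
    ∫ s, u s ∂μ ∈ D ∧ f (∫ s, u s ∂μ) = ∫ s, v s ∂μ := by
  have key : ∫ s, u s ∂μ = R (z • ∫ s, u s ∂μ - ∫ s, v s ∂μ) := by
    have hzu : Integrable (fun s => z • u s) μ := hu.smul z
    rw [← integral_smul, ← integral_sub hzu hv, ← R.integral_comp_comm (φ := fun s => z • u s - v s)
      (hzu.sub hv)]
    congr 1 with s
    rw [← huv s, h.2 _ (huD s)]
  refine ⟨key ▸ (h.1 _).1, ?_⟩
  have h2 := h.map_eq (z • ∫ s, u s ∂μ - ∫ s, v s ∂μ)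
  rw [← key] at h2
  rw [h2, sub_sub_cancel]

theorem continuousAt_resolvent {R : ℂ → E →L[ℂ] E} {a C : ℝ} {k : ℕ} (hC : 0 ≤ C)
    (hR : ∀ z : ℂ, a < z.re → IsResolvent f D z (R z))
    (hRC : ∀ z : ℂ, a < z.re → ‖R z‖ ≤ C * (1 + ‖z‖) ^ k) {z : ℂ} (hz : a < z.re) :
    ContinuousAt R z := by
  rw [ContinuousAt, tendsto_iff_norm_sub_tendsto_zero]
  have hlim : Filter.Tendsto
      (fun w : ℂ => ‖z - w‖ * ((C * (1 + ‖w‖) ^ k) * (C * (1 + ‖z‖) ^ k))) (nhds z) (nhds 0) := by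
    have h : ContinuousAt
      (fun w : ℂ => ‖z - w‖ * ((C * (1 + ‖w‖) ^ k) * (C * (1 + ‖z‖) ^ k))) z := by fun_prop
    simpa [ContinuousAt] using h
  refine squeeze_zero' (.of_forall fun _ => norm_nonneg _) ?_ hlim
  filter_upwards [(isOpen_lt continuous_const Complex.continuous_re).mem_nhds hz] with w hw
  rw [(hR w hw).sub_eq (hR z hz), norm_smul]
  refine mul_le_mul_of_nonneg_left ((norm_mul_le _ _).trans ?_) (norm_nonneg _)
  exact mul_le_mul (hRC w hw) (hRC z hz) (norm_nonneg _) (by positivity)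

theorem hasDerivAt_resolvent {R : ℂ → E →L[ℂ] E} {a C : ℝ} {k : ℕ} (hC : 0 ≤ C)
    (hR : ∀ z : ℂ, a < z.re → IsResolvent f D z (R z))
    (hRC : ∀ z : ℂ, a < z.re → ‖R z‖ ≤ C * (1 + ‖z‖) ^ k) {z : ℂ} (hz : a < z.re) :
    HasDerivAt R (-(R z * R z)) z := by
  rw [hasDerivAt_iff_tendsto_slope]
  have hcont : ContinuousAt (fun w => -(R w * R z)) z :=
    ((continuousAt_resolvent hC hR hRC hz).mul continuousAt_const).neg
  refine (hcont.tendsto.mono_left nhdsWithin_le_nhds).congr' ?_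
  filter_upwards [self_mem_nhdsWithin, mem_nhdsWithin_of_mem_nhds
    ((isOpen_lt continuous_const Complex.continuous_re).mem_nhds hz)] with w hne hw
  rw [slope_def_module, (hR w hw).sub_eq (hR z hz), smul_smul, ← neg_sub w z, mul_neg,
    inv_mul_cancel₀ (sub_ne_zero.2 hne), neg_one_smul]

end Resolvent

theorem hasDerivAt_inv_pow_linear (M b : ℂ) (n : ℕ) {z : ℂ} (hz : M * (z + b) ≠ 0) :
    HasDerivAt (fun z => ((M * (z + b)) ^ (n + 1))⁻¹)
      (-((n + 1) * M) * ((M * (z + b)) ^ (n + 2))⁻¹) z := by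
  have h := ((((hasDerivAt_id z).add_const b).const_mul M).pow (n + 1)).inv (pow_ne_zero _ hz)
  refine h.congr_deriv ?_
  simp only [id, Nat.add_sub_cancel, Pi.pow_apply, mul_one]
  rw [eq_comm, ← div_eq_mul_inv, div_eq_div_iff (pow_ne_zero _ hz)
    (pow_ne_zero _ (pow_ne_zero _ hz))]
  push_cast
  ring

theorem inv_pow_mul_pow_le {u v : ℝ} (hu : 1 ≤ u) (huv : u ≤ v) {k m n : ℕ} (h : k + m ≤ n) :
    (v ^ n)⁻¹ * u ^ k ≤ (u ^ m)⁻¹ := by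
  have hu0 : 0 < u := by linarith
  have hv0 : 0 < v := by linarith
  rw [inv_mul_le_iff₀ (by positivity), ← div_eq_mul_inv, le_div_iff₀ (by positivity), ← pow_add]
  exact (pow_le_pow_right₀ hu h).trans (pow_le_pow_left₀ hu0.le huv n)

theorem add_one_le_norm_mul_add {b : ℝ} (hb : 0 ≤ b) {z : ℂ} (hz : 1 ≤ (z + b).re) :
    1 + ‖z‖ ≤ ‖((b + 2 : ℝ) : ℂ) * (z + b)‖ := by
  rw [norm_mul, Complex.norm_real, Real.norm_of_nonneg (by linarith)]
  have h1 : 1 ≤ ‖z + b‖ := hz.trans (Complex.re_le_norm _)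
  have h2 : ‖z‖ ≤ ‖z + b‖ + b := by
    have := norm_sub_le (z + b) (b : ℂ)
    rwa [add_sub_cancel_right, Complex.norm_real, Real.norm_of_nonneg hb] at this
  nlinarith

section DampedResolvent

variable {E : Type*} [NormedAddCommGroup E] [NormedSpace ℂ E] {f : E →ₗ[ℂ] E} {D : Submodule ℂ E}
  {R : ℂ → E →L[ℂ] E} {a b C M : ℝ} {k : ℕ}

theorem norm_damped_resolvent_le (hRC : ∀ z : ℂ, a < z.re → ‖R z‖ ≤ C * (1 + ‖z‖) ^ k)
    (hQ : ∀ z : ℂ, a < z.re → 1 + ‖z‖ ≤ ‖(M : ℂ) * (z + b)‖) {m n : ℕ} (h : k + m ≤ n)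
    (hC : 0 ≤ C) {z : ℂ} (hz : a < z.re) :
    ‖((M * (z + b)) ^ n)⁻¹ • R z‖ ≤ C * ((1 + ‖z‖) ^ m)⁻¹ := by
  rw [norm_smul, norm_inv, norm_pow]
  calc _ ≤ (‖(M : ℂ) * (z + b)‖ ^ n)⁻¹ * (C * (1 + ‖z‖) ^ k) :=
        mul_le_mul_of_nonneg_left (hRC z hz) (by positivity)
    _ = C * ((‖(M : ℂ) * (z + b)‖ ^ n)⁻¹ * (1 + ‖z‖) ^ k) := by ring
    _ ≤ _ := mul_le_mul_of_nonneg_left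
      (inv_pow_mul_pow_le (by linarith [norm_nonneg z]) (hQ z hz) h) hC

theorem linear_ne_zero (hQ : ∀ z : ℂ, a < z.re → 1 + ‖z‖ ≤ ‖(M : ℂ) * (z + b)‖) {z : ℂ}
    (hz : a < z.re) : (M : ℂ) * (z + b) ≠ 0 :=
  norm_pos_iff.1 (lt_of_lt_of_le (by positivity) (hQ z hz))

/-- The damped resolvent integrates to zero along vertical lines. -/
theorem integral_damped_resolvent_eq_zero [CompleteSpace E]
    (hC : 0 ≤ C) (hM : 0 ≤ M) (hR : ∀ z : ℂ, a < z.re → IsResolvent f D z (R z))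
    (hRC : ∀ z : ℂ, a < z.re → ‖R z‖ ≤ C * (1 + ‖z‖) ^ k)
    (hQ : ∀ z : ℂ, a < z.re → 1 + ‖z‖ ≤ ‖(M : ℂ) * (z + b)‖) {n : ℕ} (hn : 2 * k + 2 ≤ n)
    {c : ℝ} (hc : a < c) :
    ∫ ξ, ((M * (vline c ξ + b)) ^ (n + 1))⁻¹ • R (vline c ξ) = 0 := by
  have hderiv : ∀ z : ℂ, a < z.re →
      HasDerivAt (fun z : ℂ => ((M * (z + b)) ^ (n + 1))⁻¹ • R z)
        (((M * (z + b)) ^ (n + 1))⁻¹ • (-(R z * R z)) +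
          (-((n + 1) * M) * ((M * (z + b)) ^ (n + 2))⁻¹) • R z) z := fun z hz =>
    (hasDerivAt_inv_pow_linear M b n (linear_ne_zero hQ hz)).smul
      (hasDerivAt_resolvent hC hR hRC hz)
  refine integral_vline_eq_zero (G := fun z : ℂ => ((M * (z + b)) ^ (n + 1))⁻¹ • R z)
    (B := C + C * C + (n + 1) * M * C) hderiv ?_ (by positivity) ?_ ?_ hc
  · have hRc : ContinuousOn R {z | a < z.re} := fun z hz =>
      (continuousAt_resolvent hC hR hRC hz).continuousWithinAt
    have hpow (m : ℕ) : ContinuousOn (fun z : ℂ => ((M * (z + b)) ^ m)⁻¹) {z | a < z.re} :=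
      ContinuousOn.inv₀ (by fun_prop) fun z hz => pow_ne_zero _ (linear_ne_zero hQ hz)
    exact ((hpow _).smul (hRc.mul hRc).neg).add ((continuousOn_const.mul (hpow _)).smul hRc)
  · intro z hz
    refine (norm_damped_resolvent_le hRC hQ (m := 3) (by lia) hC hz).trans
      (mul_le_mul_of_nonneg_right ?_ (by positivity))
    have : 0 ≤ (n + 1) * M * C := by positivity
    nlinarith
  · intro z hz
    have h1 : ‖((M * (z + b)) ^ (n + 1))⁻¹ • (-(R z * R z))‖ ≤ C * C * ((1 + ‖z‖) ^ 2)⁻¹ := by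
      rw [smul_neg, norm_neg, ← smul_mul_assoc]
      refine (norm_mul_le _ _).trans ?_
      calc _ ≤ (C * ((1 + ‖z‖) ^ (k + 2))⁻¹) * (C * (1 + ‖z‖) ^ k) :=
            mul_le_mul (norm_damped_resolvent_le hRC hQ (by lia) hC hz) (hRC z hz)
              (norm_nonneg _) (by positivity)
        _ = C * C * (((1 + ‖z‖) ^ (k + 2))⁻¹ * (1 + ‖z‖) ^ k) := by ring
        _ ≤ _ := mul_le_mul_of_nonneg_left
          (inv_pow_mul_pow_le (by linarith [norm_nonneg z]) le_rfl le_rfl) (by positivity)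
    have h2 : ‖(-((n + 1) * M) * ((M * (z + b)) ^ (n + 2))⁻¹ : ℂ) • R z‖ ≤
        (n + 1) * M * C * ((1 + ‖z‖) ^ 2)⁻¹ := by
      rw [mul_smul, norm_smul, norm_neg, norm_mul, Complex.norm_real, Real.norm_of_nonneg hM,
        mul_assoc _ C]
      refine mul_le_mul (le_of_eq ?_) (norm_damped_resolvent_le hRC hQ (by lia) hC hz)
        (norm_nonneg _) (by positivity)
      rw [← Nat.cast_succ, Complex.norm_natCast, Nat.cast_succ]
    refine (norm_add_le _ _).trans ((add_le_add h1 h2).trans ?_)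
    rw [← add_mul]
    refine mul_le_mul_of_nonneg_right ?_ (by positivity)
    linarith

end DampedResolvent

/-- If `A` is closed and densely defined with `ρ(A) ⊇ {Re λ > a}` and
`‖R(λ:A)‖ ≤ C(1+|λ|)^k` there, then `A` generates a global exponentially bounded
`K`-convoluted semigroup `(S_K(t))_{t ≥ 0}`, where `K = L^{-1}(1/P_L(-iλ))` for a
polynomial `P_L` dominating `(1+|λ|)^{k+2}`. -/
theorem stmt16 {E : Type*} [NormedAddCommGroup E] [NormedSpace ℂ E] [CompleteSpace E]
    (f : E →ₗ[ℂ] E) (D : Submodule ℂ E) (hA : IsClosedOp f D)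
    (hdense : Dense (D : Set E))
    (a C : ℝ) (k : ℕ) (hC : 0 < C)
    (hres : ∀ lam : ℂ, a < lam.re → ∃ R : E →L[ℂ] E,
      IsResolvent f D lam R ∧ ‖R‖ ≤ C * (1 + ‖lam‖) ^ k) :
    ∃ (K : ℝ → ℂ) (P : Polynomial ℂ) (S : ℝ → E →L[ℂ] E) (Mc ω : ℝ), 0 < Mc ∧
      -- `K` is the inverse Laplace transform of `1/P(-iλ)`, `P` dominating `(1+|λ|)^{k+2}`
      (∀ lam : ℂ, a < lam.re →
        (1 + ‖lam‖) ^ (k + 2) ≤ ‖P.eval (-Complex.I * lam)‖ ∧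
        (∫ t in Set.Ioi (0:ℝ), Complex.exp (-lam * t) * K t) =
          (P.eval (-Complex.I * lam))⁻¹) ∧
      -- strong continuity and exponential boundedness
      (∀ x : E, Continuous fun t => S t x) ∧
      (∀ t : ℝ, 0 ≤ t → ‖S t‖ ≤ Mc * Real.exp (ω * t)) ∧
      -- commutation with `A`
      (∀ t : ℝ, 0 ≤ t → ∀ x ∈ D, S t x ∈ D ∧ f (S t x) = S t (f x)) ∧
      -- the convoluted semigroup identity
      ∀ (x : E) (t : ℝ), 0 ≤ t →
        (∫ s in (0:ℝ)..t, S s x) ∈ D ∧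
        f (∫ s in (0:ℝ)..t, S s x) = S t x - (∫ s in (0:ℝ)..t, K s) • x := by
  choose! R hR hRC using hres
  set b : ℝ := |a| + 1 with hb
  set c : ℝ := |a| + 2 with hc
  set M : ℝ := b + 2 with hM
  set n : ℕ := 2 * k + 2 with hn
  have hb0 : 0 < b := by positivity
  have hc0 : 0 < c := by positivity
  have hM0 : 0 ≤ M := by positivity
  have hac : a < c := by linarith [le_abs_self a]
  have hre : ∀ z : ℂ, a < z.re → 1 ≤ (z + b).re := fun z hz => by
    rw [Complex.add_re, Complex.ofReal_re]
    linarith [neg_abs_le a]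
  have hQ : ∀ z : ℂ, a < z.re → 1 + ‖z‖ ≤ ‖(M : ℂ) * (z + b)‖ := fun z hz =>
    add_one_le_norm_mul_add hb0.le (hre z hz)
  set q : ℂ → ℂ := fun z => ((M * (z + b)) ^ (n + 1))⁻¹ with hq
  have hqc : ContinuousOn q {z | a < z.re} :=
    ContinuousOn.inv₀ (by fun_prop) fun z hz => pow_ne_zero _ (linear_ne_zero hQ hz)
  have hRc : ContinuousOn R {z | a < z.re} := fun z hz =>
    (continuousAt_resolvent hC.le hR hRC hz).continuousWithinAt
  obtain ⟨hqv, hqi⟩ := integrable_vline_of_norm_le (B := 1) hqc (fun z hz => by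
    rw [hq, norm_inv, norm_pow]
    simpa using inv_pow_mul_pow_le (k := 0) (m := 2) (n := n + 1)
      (by linarith [norm_nonneg z]) (hQ z hz) (by lia)) zero_le_one hac
  obtain ⟨hGv, hGi⟩ := integrable_vline_of_norm_le (hqc.smul hRc)
    (fun z hz => norm_damped_resolvent_le hRC hQ (m := 2) (n := n + 1) (by lia) hC.le hz)
    hC.le hac
  set G : ℝ → E →L[ℂ] E := fun ξ => q (vline c ξ) • R (vline c ξ) with hG
  change Continuous G at hGv
  change Integrable G at hGi
  have hGxi (x : E) : Integrable fun ξ => G ξ x := hGi.apply_continuousLinearMap x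
  have hS (x : E) (t : ℝ) : vlineIntegral c G t x = vlineIntegral c (fun ξ => G ξ x) t :=
    ContinuousLinearMap.integral_apply (integrable_exp_vline_smul c t hGi) x
  refine ⟨convKernel M b n,
    (Polynomial.C (M : ℂ) * (Polynomial.C Complex.I * X + Polynomial.C (b : ℂ))) ^ (n + 1),
    vlineIntegral c G, (∫ ξ, ‖G ξ‖) + 1, c, ?_, ?_, ?_, ?_, ?_, ?_⟩
  · positivity
  · intro z hz
    have hP : ((Polynomial.C (M : ℂ) * (Polynomial.C Complex.I * X + Polynomial.C (b : ℂ))) ^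
        (n + 1)).eval (-Complex.I * z) = (M * (z + b)) ^ (n + 1) := by
      simp only [eval_pow, eval_mul, eval_add, eval_C, eval_X]
      rw [← mul_assoc, mul_neg, Complex.I_mul_I, neg_neg, one_mul]
    rw [hP]
    refine ⟨?_, laplace_convKernel M b n (by linarith [hre z hz])⟩
    rw [norm_pow]
    exact (pow_le_pow_right₀ (by linarith [norm_nonneg z]) (by lia)).trans
      (pow_le_pow_left₀ (by positivity) (hQ z hz) _)
  · intro x
    simp only [hS]
    exact continuous_vlineIntegral c (hGxi x)
  · intro t _
    refine (norm_vlineIntegral_le c t G).trans ?_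
    exact mul_le_mul_of_nonneg_right (by linarith) (Real.exp_pos _).le
  · intro t _ x hx
    rw [hS, hS]
    refine (hR c hac).integral_mem (integrable_exp_vline_smul c t (hGxi x))
      (integrable_exp_vline_smul c t (hGxi (f x))) (fun ξ => ?_) fun ξ => ?_
    · exact D.smul_mem _ (D.smul_mem _ ((hR _ hac).1 x).1)
    · simp only [hG, smul_apply, map_smul]
      rw [(hR (vline c ξ) hac).map_comm_s16 hx]
  · intro x t ht
    have hZ : ∫ s in (0 : ℝ)..t, vlineIntegral c G s x = ∫ ξ, vlineKernel c t ξ • G ξ x := by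
      simp only [hS]
      exact intervalIntegral_vlineIntegral hc0 ht (hGv.clm_apply continuous_const) (hGxi x)
    have hK : ∫ s in (0 : ℝ)..t, convKernel M b n s =
        ∫ ξ, vlineKernel c t ξ • q (vline c ξ) := by
      rw [← intervalIntegral_vlineIntegral hc0 ht hqv hqi]
      simp only [hq, vlineIntegral_inv_pow (M := M) (by lia : n ≠ 0) (add_pos hc0 hb0) hqi]
    have hG0 : ∫ ξ, G ξ x = 0 := by
      rw [← ContinuousLinearMap.integral_apply hGi, hG,
        integral_damped_resolvent_eq_zero hC.le hM0 hR hRC hQ le_rfl hac]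
      rfl
    have hi1 := integrable_exp_vline_smul c t (hGxi x)
    have hi2 := (integrable_vlineKernel_smul hc0 t hqi).smul_const x
    rw [hZ]
    have hmem := (hR c hac).integral_mem (integrable_vlineKernel_smul hc0 t (hGxi x))
      (v := fun ξ => Complex.exp (vline c ξ * t) • G ξ x - G ξ x -
        (vlineKernel c t ξ • q (vline c ξ)) • x) ((hi1.sub (hGxi x)).sub hi2)
      (fun ξ => D.smul_mem _ (D.smul_mem _ ((hR _ hac).1 x).1)) fun ξ => by
        have h0 := vline_ne_zero hc0 ξ
        have hk : vlineKernel c t ξ * vline c ξ = Complex.exp (vline c ξ * t) - 1 :=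
          div_mul_cancel₀ _ h0
        simp only [hG, smul_apply, map_smul]
        rw [(hR (vline c ξ) hac).map_eq, ← sub_add_cancel (Complex.exp (vline c ξ * t)) 1, ← hk]
        simp only [smul_eq_mul]
        module
    refine ⟨hmem.1, hmem.2.trans ?_⟩
    have hi12 : Integrable fun ξ => Complex.exp (vline c ξ * t) • G ξ x - G ξ x :=
      hi1.sub (hGxi x)
    rw [integral_sub hi12 hi2, integral_sub hi1 (hGxi x), hG0, sub_zero, hS, integral_smul_const,
      hK]
    rfl
end
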